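/- Let φ : ℝ³ → ℝ be smooth, nonnegative, radial, radially nonincreasing, with φ(x) = 1 for |x| ≤ 1 and φ(x) = 0 for |x| ≥ 2. Then there is a constant C > 0 (depending only on φ) with the following property: for every smooth global solution u of the defocusing quintic nonlinear wave equation with E(u(t)) ≤ E for all t, every R₀ > 0, every J ≥ 1, every a ∈ ℝ, and every T with 0 < T ≤ 𝒯 := e^J R₀, there exist t₀ ∈ [a + T, a + 𝒯 + T] and R ∈ [R₀, e^J R₀] such that ∫_{t₀−T}^{t₀} ∫_{ℝ³} ∫_{ℝ³} [ (1/2)( |∇ₓu(t,x)| − |∂ₜu(t,x)| )² + (1/6) u(t,x)⁶ ] · φ((x−y)/R) · [ (1/2) ∂ₜu(t,y)² + (1/2) |∇ₓu(t,y)|² + (2/3) u(t,y)⁶ ] dx dy dt ≤ C T E² / J. -/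

import Mathlib

open MeasureTheory Real Set Function
open scoped ENNReal NNReal FourierTransform

noncomputable section

/-- Three-dimensional Euclidean space `ℝ³`. -/
abbrev E3 : Type := EuclideanSpace ℝ (Fin 3)

/-- The time derivative `∂ₜ u` of a function `u : ℝ × ℝ³ → ℝ` (curried). -/
def tderiv (u : ℝ → E3 → ℝ) (t : ℝ) (x : E3) : ℝ := deriv (fun s => u s x) t

/-- The second time derivative `∂ₜ² u`. -/
def tderiv2 (u : ℝ → E3 → ℝ) (t : ℝ) (x : E3) : ℝ := deriv (fun s => tderiv u s x) t

/-- The spatial Laplacian `Δ f = ∑ᵢ ∂ᵢ² f` of `f : ℝ³ → ℝ`. -/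
def lap (f : E3 → ℝ) (x : E3) : ℝ :=
  ∑ i : Fin 3, iteratedFDeriv ℝ 2 f x ![EuclideanSpace.single i 1, EuclideanSpace.single i 1]

/-- `f : ℝ³ → ℝ` is a Schwartz function: it is smooth and all of its derivatives decay
faster than any polynomial. -/
def IsSchwartz (f : E3 → ℝ) : Prop :=
  ContDiff ℝ (⊤ : ℕ∞) f ∧ ∀ k n : ℕ, ∃ C : ℝ, ∀ x, ‖x‖ ^ k * ‖iteratedFDeriv ℝ n f x‖ ≤ C

/-- `u` is a smooth solution of the defocusing quintic nonlinear wave equation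
`∂ₜ²u − Δu + u⁵ = 0` on the time interval `I`, Schwartz in the space variable at each time. -/
def IsNLWOn (u : ℝ → E3 → ℝ) (I : Set ℝ) : Prop :=
  ContDiffOn ℝ (⊤ : ℕ∞) (uncurry u) (I ×ˢ univ) ∧
  (∀ t ∈ I, IsSchwartz (u t) ∧ IsSchwartz (tderiv u t)) ∧
  (∀ t ∈ I, ∀ x, tderiv2 u t x - lap (u t) x + (u t x) ^ 5 = 0)

/-- `u` is a smooth global solution of the defocusing quintic nonlinear wave equation. -/
def IsNLW (u : ℝ → E3 → ℝ) : Prop := IsNLWOn u univ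

/-- The energy `E(u(t)) = ∫ (1/2)|∂ₜu|² + (1/2)|∇ₓu|² + (1/6)u⁶ dx`. -/
def energy (u : ℝ → E3 → ℝ) (t : ℝ) : ℝ :=
  ∫ x : E3, ((1/2) * (tderiv u t x) ^ 2 + (1/2) * ‖gradient (u t) x‖ ^ 2 + (1/6) * (u t x) ^ 6)

/-- The spatial `L^q` norm (`q` finite), valued in `ℝ≥0∞`. -/
def xNorm {F : Type*} [NormedAddCommGroup F] (q : ℝ) (f : E3 → F) : ℝ≥0∞ :=
  (∫⁻ x : E3, (‖f x‖₊ : ℝ≥0∞) ^ q) ^ (1/q)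

/-- The mixed norm `‖u‖_{L^p_t L^q_x (I × ℝ³)}` for finite `p, q`. -/
def mixNorm (p q : ℝ) (I : Set ℝ) (u : ℝ → E3 → ℝ) : ℝ≥0∞ :=
  (∫⁻ t in I, (xNorm q (u t)) ^ p) ^ (1/p)

/-- The mixed norm `‖u‖_{L^∞_t L^q_x (I × ℝ³)}` (essential supremum in time). -/
def supNorm (q : ℝ) (I : Set ℝ) (u : ℝ → E3 → ℝ) : ℝ≥0∞ :=
  essSup (fun t => xNorm q (u t)) (volume.restrict I)

/-- The homogeneous Sobolev norm `‖f‖_{Ḣ^s} = (∫ |ξ|^{2s} |𝓕f(ξ)|² dξ)^{1/2}`. -/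
def sobNorm (s : ℝ) (f : E3 → ℝ) : ℝ≥0∞ :=
  (∫⁻ ξ : E3, (‖ξ‖₊ : ℝ≥0∞) ^ (2*s) *
    (‖𝓕 (fun x => (f x : ℂ)) ξ‖₊ : ℝ≥0∞) ^ (2:ℝ)) ^ ((1:ℝ)/2)

/-- The a priori bounds with constant `A`:
`‖u(t)‖_{L²} ≤ A`, `‖∂ₜu(t)‖_{Ḣ⁻¹} ≤ A`, `‖u(t)‖_{Ḣ²} ≤ A`, `‖∂ₜu(t)‖_{Ḣ¹} ≤ A` for all `t`. -/
def APriori (u : ℝ → E3 → ℝ) (A : ℝ) : Prop :=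
  ∀ t : ℝ, xNorm 2 (u t) ≤ ENNReal.ofReal A ∧ sobNorm (-1) (tderiv u t) ≤ ENNReal.ofReal A ∧
    sobNorm 2 (u t) ≤ ENNReal.ofReal A ∧ sobNorm 1 (tderiv u t) ≤ ENNReal.ofReal A

/-- The integral of `f` over the sphere of radius `r` about `x`, with respect to
two-dimensional Hausdorff (surface) measure. -/
def sphInt (x : E3) (r : ℝ) (f : E3 → ℝ) : ℝ := ∫ y in Metric.sphere x r, f y ∂(μH[2])

/-- The free wave evolution `S(t)(g, h)` given by Kirchhoff's formula. -/
def freeWave (g h : E3 → ℝ) (t : ℝ) (x : E3) : ℝ :=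
  if t = 0 then g x
  else deriv (fun s => (1/(4*π*s)) * sphInt x s g) t + (1/(4*π*t)) * sphInt x t h

/-- The Duhamel integral `D_{[s₁,s₂]}u(t,x) = ∫_{s₁}^{s₂} S(t−τ)(0, u(τ)⁵) dτ`,
written via Kirchhoff's formula. -/
def duh (u : ℝ → E3 → ℝ) (s₁ s₂ : ℝ) (t : ℝ) (x : E3) : ℝ :=
  ∫ τ in s₁..s₂, (1/(4*π*(t - τ))) * sphInt x (t - τ) (fun y => (u τ y) ^ 5)



/-- The time derivative of a function on spacetime. -/
def dt (f : ℝ × E3 → ℝ) (z : ℝ × E3) : ℝ := fderiv ℝ f z (1, 0)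

/-- The `k`-th spatial partial derivative of a function on spacetime. -/
def dx (k : Fin 3) (f : ℝ × E3 → ℝ) (z : ℝ × E3) : ℝ :=
  fderiv ℝ f z (0, EuclideanSpace.single k 1)

theorem ContDiff.dt {f : ℝ × E3 → ℝ} (hf : ContDiff ℝ (⊤ : ℕ∞) f) :
    ContDiff ℝ (⊤ : ℕ∞) (dt f) :=
  (hf.fderiv_right (m := (⊤ : ℕ∞)) (by simp)).clm_apply contDiff_const

theorem ContDiff.dx {f : ℝ × E3 → ℝ} (hf : ContDiff ℝ (⊤ : ℕ∞) f) (k : Fin 3) :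
    ContDiff ℝ (⊤ : ℕ∞) (dx k f) :=
  (hf.fderiv_right (m := (⊤ : ℕ∞)) (by simp)).clm_apply contDiff_const

theorem hasDerivAt_dt {f : ℝ × E3 → ℝ} (hf : ContDiff ℝ (⊤ : ℕ∞) f) (t : ℝ) (x : E3) :
    HasDerivAt (fun s => f (s, x)) (dt f (t, x)) t := by
  have h1 : HasFDerivAt f (fderiv ℝ f (t, x)) (t, x) :=
    (hf.differentiable (by simp) _).hasFDerivAt
  exact h1.comp_hasDerivAt t ((hasDerivAt_id t).prodMk (hasDerivAt_const t x))

theorem hasDerivAt_dx {f : ℝ × E3 → ℝ} (hf : ContDiff ℝ (⊤ : ℕ∞) f) (k : Fin 3) (t : ℝ)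
    (x : E3) :
    HasDerivAt (fun s : ℝ => f (t, x + s • EuclideanSpace.single k 1)) (dx k f (t, x)) 0 := by
  have h1 : HasFDerivAt f (fderiv ℝ f (t, x)) (t, x + (0 : ℝ) • EuclideanSpace.single k 1) := by
    simpa using (hf.differentiable (by simp) (t, x)).hasFDerivAt
  have h2 : HasDerivAt (fun s : ℝ => (t, x + s • (EuclideanSpace.single k 1 : E3)))
      (0, EuclideanSpace.single k 1) 0 := by
    have := ((hasDerivAt_id (0 : ℝ)).smul_const (EuclideanSpace.single k 1 : E3)).const_add x
    simpa using (hasDerivAt_const (0 : ℝ) t).prodMk this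
  exact h1.comp_hasDerivAt (0 : ℝ) h2

/-- The integral of a directional derivative vanishes. -/
theorem integral_eq_zero_of_hasLineDerivAt {W : Type*} [NormedAddCommGroup W] [NormedSpace ℝ W]
    [FiniteDimensional ℝ W] [MeasurableSpace W] [BorelSpace W] {μ : Measure W}
    [μ.IsAddHaarMeasure] {f f' : W → ℝ} {v : W} (hf : Integrable f μ) (hf' : Integrable f' μ)
    (h : ∀ x, HasLineDerivAt ℝ f (f' x) x v) : ∫ x, f' x ∂μ = 0 := by
  have := integral_bilinear_hasLineDerivAt_right_eq_neg_left_of_integrable (μ := μ)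
    (f := f) (f' := f') (g := fun _ => (1 : ℝ)) (g' := fun _ => (0 : ℝ)) (v := v)
    (B := ContinuousLinearMap.mul ℝ ℝ) (by simpa using hf') (by simp) (by simpa using hf)
    (fun x _ => h x) (fun x _ => hasDerivAt_const (0 : ℝ) (1 : ℝ))
  simpa using this.symm

/-- Differentiation under the integral sign for integrands supported in a fixed compact set. -/
theorem hasDerivAt_integral_of_compact_support {W : Type*} [TopologicalSpace W] [T2Space W]
    [SecondCountableTopology W]
    [MeasurableSpace W] [OpensMeasurableSpace W] {μ : Measure W} [IsFiniteMeasureOnCompacts μ]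
    {F F' : ℝ → W → ℝ} {K : Set W} (hK : IsCompact K) (hF : ∀ t, Continuous (F t))
    (hF' : Continuous (uncurry F')) (h0 : ∀ t, ∀ w ∉ K, F t w = 0)
    (hd : ∀ t w, HasDerivAt (fun s => F s w) (F' t w) t) (t : ℝ) :
    HasDerivAt (fun s => ∫ w, F s w ∂μ) (∫ w, F' t w ∂μ) t := by
  have h0' : ∀ t, ∀ w ∉ K, F' t w = 0 := by
    intro t w hw
    have h1 := hd t w
    have h2 : (fun s => F s w) = fun _ => 0 := by ext s; exact h0 s w hw
    rw [h2] at h1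
    exact h1.unique (hasDerivAt_const t (0 : ℝ))
  obtain ⟨C, hC⟩ := ((isCompact_Icc (a := t - 1) (b := t + 1)).prod hK).exists_bound_of_continuousOn
    hF'.continuousOn
  refine (hasDerivAt_integral_of_dominated_loc_of_deriv_le
    (bound := K.indicator (fun _ => C)) (s := Icc (t - 1) (t + 1)) (F' := F')
    (Icc_mem_nhds (by linarith) (by linarith)) ?_ ?_ ?_ ?_ ?_ ?_).2
  · exact Filter.Eventually.of_forall fun s => (hF s).aestronglyMeasurable
  · exact (hF t).integrable_of_hasCompactSupport
      (HasCompactSupport.intro hK (h0 t))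
  · exact (hF'.comp (Continuous.prodMk_right t)).aestronglyMeasurable
  · refine ae_of_all _ fun w s hs => ?_
    by_cases hw : w ∈ K
    · simpa [hw] using hC (s, w) ⟨hs, hw⟩
    · simp [hw, h0' s w hw]
  · exact (integrable_indicator_iff hK.measurableSet).2
      (integrableOn_const hK.measure_lt_top.ne)
  · exact ae_of_all _ fun w s _ => hd s w

instance isAddHaarMeasure_volume_prod : (volume : Measure (E3 × E3)).IsAddHaarMeasure :=
  Measure.prod.instIsAddHaarMeasure (volume : Measure E3) (volume : Measure E3)

theorem hasDerivAt_interaction_aux {K : E3 × E3 → ℝ} (hK : ContDiff ℝ (⊤ : ℕ∞) K)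
    (hKc : HasCompactSupport K) {ρ σ s : ℝ × E3 → ℝ} {j J : Fin 3 → ℝ × E3 → ℝ}
    (hρ : ContDiff ℝ (⊤ : ℕ∞) ρ) (hσ : ContDiff ℝ (⊤ : ℕ∞) σ) (hs : ContDiff ℝ (⊤ : ℕ∞) s)
    (hj : ∀ k, ContDiff ℝ (⊤ : ℕ∞) (j k)) (hJ : ∀ k, ContDiff ℝ (⊤ : ℕ∞) (J k))
    (hρj : ∀ z, dt ρ z + ∑ k, dx k (j k) z = 0)
    (hσJ : ∀ z, dt σ z + ∑ k, dx k (J k) z = s z) (t : ℝ) :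
    Integrable (fun w : E3 × E3 => K w * (ρ (t, w.1) * σ (t, w.2))) ∧
    Integrable (fun w : E3 × E3 =>
      (∑ k, (fderiv ℝ K w (EuclideanSpace.single k 1, 0) * (j k (t, w.1) * σ (t, w.2)) +
        fderiv ℝ K w (0, EuclideanSpace.single k 1) * (ρ (t, w.1) * J k (t, w.2)))) +
      K w * (ρ (t, w.1) * s (t, w.2))) ∧
    HasDerivAt (fun t => ∫ w : E3 × E3, K w * (ρ (t, w.1) * σ (t, w.2)))
      (∫ w : E3 × E3,
        ((∑ k, (fderiv ℝ K w (EuclideanSpace.single k 1, 0) * (j k (t, w.1) * σ (t, w.2)) +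
          fderiv ℝ K w (0, EuclideanSpace.single k 1) * (ρ (t, w.1) * J k (t, w.2)))) +
        K w * (ρ (t, w.1) * s (t, w.2)))) t := by
  have cρ := hρ.continuous
  have cσ := hσ.continuous
  have cs := hs.continuous
  have cj := fun k => (hj k).continuous
  have cJ := fun k => (hJ k).continuous
  have cdρ := hρ.dt.continuous
  have cdσ := hσ.dt.continuous
  have cdj := fun k => ((hj k).dx k).continuous
  have cdJ := fun k => ((hJ k).dx k).continuous
  have cK := hK.continuous
  have cdK : ∀ v, Continuous fun w => fderiv ℝ K w v := fun v =>
    ((hK.continuous_fderiv (by simp))).clm_apply continuous_const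
  have int1 : ∀ g : E3 × E3 → ℝ, Continuous g → Integrable (fun w => K w * g w) := fun g hg =>
    (cK.mul hg).integrable_of_hasCompactSupport hKc.mul_right
  have int2 : ∀ v, ∀ g : E3 × E3 → ℝ, Continuous g →
      Integrable (fun w => fderiv ℝ K w v * g w) := fun v g hg =>
    ((cdK v).mul hg).integrable_of_hasCompactSupport (hKc.fderiv_apply (𝕜 := ℝ) v).mul_right
  set A : Fin 3 → E3 × E3 → ℝ := fun k w =>
    fderiv ℝ K w (EuclideanSpace.single k 1, 0) * (j k (t, w.1) * σ (t, w.2)) with hA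
  set B : Fin 3 → E3 × E3 → ℝ := fun k w =>
    fderiv ℝ K w (0, EuclideanSpace.single k 1) * (ρ (t, w.1) * J k (t, w.2)) with hB
  set A' : Fin 3 → E3 × E3 → ℝ := fun k w =>
    K w * (dx k (j k) (t, w.1) * σ (t, w.2)) with hA'
  set B' : Fin 3 → E3 × E3 → ℝ := fun k w =>
    K w * (ρ (t, w.1) * dx k (J k) (t, w.2)) with hB'
  have iA : ∀ k, Integrable (A k) := fun k => int2 _ _ (by fun_prop)
  have iB : ∀ k, Integrable (B k) := fun k => int2 _ _ (by fun_prop)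
  have iA' : ∀ k, Integrable (A' k) := fun k => int1 _ (by fun_prop)
  have iB' : ∀ k, Integrable (B' k) := fun k => int1 _ (by fun_prop)
  have iS : Integrable fun w : E3 × E3 => K w * (ρ (t, w.1) * s (t, w.2)) :=
    int1 _ (by fun_prop)
  have zA : ∀ k, ∫ w, (A k w + A' k w) = 0 := by
    intro k
    refine integral_eq_zero_of_hasLineDerivAt
      (f := fun w => K w * (j k (t, w.1) * σ (t, w.2)))
      (v := (EuclideanSpace.single k 1, 0)) (int1 _ (by fun_prop))
      ((iA k).add (iA' k)) fun w => ?_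
    have h1 := (hK.differentiable (by simp) w).hasFDerivAt.hasLineDerivAt
      (EuclideanSpace.single k 1, 0)
    have h2 := hasDerivAt_dx (hj k) k t w.1
    have h3 := HasDerivAt.mul h1 (h2.mul_const (σ (t, w.2)))
    unfold HasLineDerivAt
    convert! h3 using 1
    · ext r; simp
    · simp [hA, hA']
  have zB : ∀ k, ∫ w, (B k w + B' k w) = 0 := by
    intro k
    refine integral_eq_zero_of_hasLineDerivAt
      (f := fun w => K w * (ρ (t, w.1) * J k (t, w.2)))
      (v := (0, EuclideanSpace.single k 1)) (int1 _ (by fun_prop))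
      ((iB k).add (iB' k)) fun w => ?_
    have h1 := (hK.differentiable (by simp) w).hasFDerivAt.hasLineDerivAt
      (0, EuclideanSpace.single k 1)
    have h2 := hasDerivAt_dx (hJ k) k t w.2
    have h3 := HasDerivAt.mul h1 (h2.const_mul (ρ (t, w.1)))
    unfold HasLineDerivAt
    convert! h3 using 1
    · ext r; simp
    · simp [hB, hB']
  have iAB : Integrable fun w => (∑ k, (A k w + B k w)) :=
    integrable_finsetSum _ fun k _ => (iA k).add (iB k)
  refine ⟨int1 _ (by fun_prop), iAB.add iS, ?_⟩
  have hd := hasDerivAt_integral_of_compact_support (μ := (volume : Measure (E3 × E3)))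
    (F := fun t w => K w * (ρ (t, w.1) * σ (t, w.2)))
    (F' := fun t w => K w * (dt ρ (t, w.1) * σ (t, w.2) + ρ (t, w.1) * dt σ (t, w.2)))
    (K := tsupport K) hKc (fun t => by fun_prop)
    (by simp only [uncurry_def]; fun_prop)
    (fun t w hw => by simp [image_eq_zero_of_notMem_tsupport hw])
    (fun t w => ((hasDerivAt_dt hρ t w.1).mul (hasDerivAt_dt hσ t w.2)).const_mul _) t
  convert! hd using 1
  have e1 : ∀ w, K w * (dt ρ (t, w.1) * σ (t, w.2) + ρ (t, w.1) * dt σ (t, w.2)) =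
      ((∑ k, (A k w + B k w)) + K w * (ρ (t, w.1) * s (t, w.2))) -
      ∑ k, ((A k w + A' k w) + (B k w + B' k w)) := by
    intro w
    have h1 := hρj (t, w.1)
    have h2 := hσJ (t, w.2)
    rw [Fin.sum_univ_three] at h1 h2
    simp only [Fin.sum_univ_three, hA', hB']
    linear_combination K w * σ (t, w.2) * h1 + K w * ρ (t, w.1) * h2
  have iABk : ∀ k, Integrable fun w => (A k w + A' k w) + (B k w + B' k w) :=
    fun k => ((iA k).add (iA' k)).add ((iB k).add (iB' k))
  have iAB' : Integrable fun w => ∑ k, ((A k w + A' k w) + (B k w + B' k w)) :=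
    integrable_finsetSum _ fun k _ => iABk k
  have e2 : ∫ w, ∑ k, ((A k w + A' k w) + (B k w + B' k w)) = 0 := by
    rw [integral_finsetSum _ fun k _ => iABk k]
    refine Finset.sum_eq_zero fun k _ => ?_
    have := integral_add ((iA k).add (iA' k)) ((iB k).add (iB' k))
    simp only [Pi.add_apply] at this
    rw [this, zA, zB, add_zero]
  have e3 := integral_sub (iAB.add iS) iAB'
  simp only [Pi.add_apply] at e3
  simp_rw [e1]
  rw [e3, e2, sub_zero]

/-- Evolution of a two-particle interaction functional between a conserved density `ρ` with
flux `j` and densities `σ i` with fluxes `J i` and sources `s i`. -/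
theorem hasDerivAt_interaction {ι : Type*} [Fintype ι] {K : ι → E3 × E3 → ℝ}
    (hK : ∀ i, ContDiff ℝ (⊤ : ℕ∞) (K i))
    (hKc : ∀ i, HasCompactSupport (K i)) {ρ : ℝ × E3 → ℝ} {σ s : ι → ℝ × E3 → ℝ}
    {j : Fin 3 → ℝ × E3 → ℝ} {J : ι → Fin 3 → ℝ × E3 → ℝ}
    (hρ : ContDiff ℝ (⊤ : ℕ∞) ρ) (hσ : ∀ i, ContDiff ℝ (⊤ : ℕ∞) (σ i))
    (hs : ∀ i, ContDiff ℝ (⊤ : ℕ∞) (s i))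
    (hj : ∀ k, ContDiff ℝ (⊤ : ℕ∞) (j k)) (hJ : ∀ i k, ContDiff ℝ (⊤ : ℕ∞) (J i k))
    (hρj : ∀ z, dt ρ z + ∑ k, dx k (j k) z = 0)
    (hσJ : ∀ i z, dt (σ i) z + ∑ k, dx k (J i k) z = s i z) (t : ℝ) :
    Integrable (fun w : E3 × E3 => ∑ i, K i w * (ρ (t, w.1) * σ i (t, w.2))) ∧
    Integrable (fun w : E3 × E3 => ∑ i,
      ((∑ k, (fderiv ℝ (K i) w (EuclideanSpace.single k 1, 0) * (j k (t, w.1) * σ i (t, w.2)) +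
        fderiv ℝ (K i) w (0, EuclideanSpace.single k 1) * (ρ (t, w.1) * J i k (t, w.2)))) +
      K i w * (ρ (t, w.1) * s i (t, w.2)))) ∧
    HasDerivAt (fun t => ∫ w : E3 × E3, ∑ i, K i w * (ρ (t, w.1) * σ i (t, w.2)))
      (∫ w : E3 × E3, ∑ i,
        ((∑ k, (fderiv ℝ (K i) w (EuclideanSpace.single k 1, 0) * (j k (t, w.1) * σ i (t, w.2)) +
          fderiv ℝ (K i) w (0, EuclideanSpace.single k 1) * (ρ (t, w.1) * J i k (t, w.2)))) +
        K i w * (ρ (t, w.1) * s i (t, w.2)))) t := by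
  have h := fun i t => hasDerivAt_interaction_aux (hK i) (hKc i) hρ (hσ i) (hs i) hj (hJ i) hρj
    (hσJ i) t
  refine ⟨integrable_finsetSum _ fun i _ => (h i t).1,
    integrable_finsetSum _ fun i _ => (h i t).2.1, ?_⟩
  rw [integral_finsetSum _ fun i _ => (h i t).2.1]
  simp_rw [fun t => integral_finsetSum Finset.univ fun i _ => (h i t).1]
  exact HasDerivAt.fun_sum fun i _ => (h i t).2.2

theorem dx_dt_comm {f : ℝ × E3 → ℝ} (hf : ContDiff ℝ (⊤ : ℕ∞) f) (k : Fin 3) (z : ℝ × E3) :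
    dt (dx k f) z = dx k (dt f) z := by
  have hd : DifferentiableAt ℝ (fderiv ℝ f) z :=
    (hf.fderiv_right (m := (⊤ : ℕ∞)) (by simp)).differentiable (by simp) z
  have h := (hf.contDiffAt (x := z)).isSymmSndFDerivAt
    (by simpa using (WithTop.coe_le_coe.2 (le_top : (2 : ℕ∞) ≤ ⊤)))
  have e : ∀ v w, fderiv ℝ (fun z => fderiv ℝ f z v) z w = fderiv ℝ (fderiv ℝ f) z w v := by
    intro v w
    simp [fderiv_clm_apply hd (differentiableAt_const v)]
  exact (e _ _).trans ((h _ _).trans (e _ _).symm)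

theorem dx_dx_comm {f : ℝ × E3 → ℝ} (hf : ContDiff ℝ (⊤ : ℕ∞) f) (j k : Fin 3) (z : ℝ × E3) :
    dx j (dx k f) z = dx k (dx j f) z := by
  have hd : DifferentiableAt ℝ (fderiv ℝ f) z :=
    (hf.fderiv_right (m := (⊤ : ℕ∞)) (by simp)).differentiable (by simp) z
  have h := (hf.contDiffAt (x := z)).isSymmSndFDerivAt
    (by simpa using (WithTop.coe_le_coe.2 (le_top : (2 : ℕ∞) ≤ ⊤)))
  have e : ∀ v w, fderiv ℝ (fun z => fderiv ℝ f z v) z w = fderiv ℝ (fderiv ℝ f) z w v := by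
    intro v w
    simp [fderiv_clm_apply hd (differentiableAt_const v)]
  exact (e _ _).trans ((h _ _).trans (e _ _).symm)

/-- The energy density. -/
def enD (U : ℝ × E3 → ℝ) (z : ℝ × E3) : ℝ :=
  1 / 2 * dt U z ^ 2 + 1 / 2 * ∑ k, dx k U z ^ 2 + 1 / 6 * U z ^ 6

/-- The momentum density. -/
def moD (U : ℝ × E3 → ℝ) (k : Fin 3) (z : ℝ × E3) : ℝ := -(dt U z * dx k U z)

/-- The diagonal part of the stress tensor. -/
def prD (U : ℝ × E3 → ℝ) (z : ℝ × E3) : ℝ :=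
  1 / 2 * dt U z ^ 2 - 1 / 2 * ∑ k, dx k U z ^ 2 - 1 / 6 * U z ^ 6

/-- The stress tensor. -/
def stD (U : ℝ × E3 → ℝ) (j k : Fin 3) (z : ℝ × E3) : ℝ :=
  dx j U z * dx k U z + if k = j then prD U z else 0

section Conservation

variable {U : ℝ × E3 → ℝ}

theorem contDiff_enD (hU : ContDiff ℝ (⊤ : ℕ∞) U) : ContDiff ℝ (⊤ : ℕ∞) (enD U) := by
  have h1 := hU.dt
  have h2 := hU.dx
  unfold enD
  exact ((contDiff_const.mul (h1.pow 2)).add (contDiff_const.mul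
    (ContDiff.sum fun k _ => (h2 k).pow 2))).add (contDiff_const.mul (hU.pow 6))

theorem contDiff_moD (hU : ContDiff ℝ (⊤ : ℕ∞) U) (k : Fin 3) :
    ContDiff ℝ (⊤ : ℕ∞) (moD U k) := (hU.dt.mul (hU.dx k)).neg

theorem contDiff_prD (hU : ContDiff ℝ (⊤ : ℕ∞) U) : ContDiff ℝ (⊤ : ℕ∞) (prD U) := by
  have h1 := hU.dt
  have h2 := hU.dx
  unfold prD
  exact ((contDiff_const.mul (h1.pow 2)).sub (contDiff_const.mul
    (ContDiff.sum fun k _ => (h2 k).pow 2))).sub (contDiff_const.mul (hU.pow 6))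

theorem contDiff_stD (hU : ContDiff ℝ (⊤ : ℕ∞) U) (j k : Fin 3) :
    ContDiff ℝ (⊤ : ℕ∞) (stD U j k) := by
  unfold stD
  refine ((hU.dx j).mul (hU.dx k)).add ?_
  split_ifs
  · exact contDiff_prD hU
  · exact contDiff_const

theorem fderiv_enD (hU : ContDiff ℝ (⊤ : ℕ∞) U) (z v : ℝ × E3) :
    fderiv ℝ (enD U) z v = dt U z * fderiv ℝ (dt U) z v +
      ∑ k, dx k U z * fderiv ℝ (dx k U) z v + U z ^ 5 * fderiv ℝ U z v := by
  have h0 := (hU.differentiable (by simp) z).hasFDerivAt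
  have h1 := (hU.dt.differentiable (by simp) z).hasFDerivAt
  have h2 := fun k => ((hU.dx k).differentiable (by simp) z).hasFDerivAt
  have h := (((h1.pow 2).const_mul (1 / 2)).add ((HasFDerivAt.fun_sum
    fun k (_ : k ∈ Finset.univ) => (h2 k).pow 2).const_mul (1 / 2))).add
    ((h0.pow 6).const_mul (1 / 6))
  have h' : HasFDerivAt (enD U) _ z := h
  rw [h'.fderiv]
  simp [Fin.sum_univ_three]
  ring

theorem fderiv_prD (hU : ContDiff ℝ (⊤ : ℕ∞) U) (z v : ℝ × E3) :
    fderiv ℝ (prD U) z v = dt U z * fderiv ℝ (dt U) z v -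
      ∑ k, dx k U z * fderiv ℝ (dx k U) z v - U z ^ 5 * fderiv ℝ U z v := by
  have h0 := (hU.differentiable (by simp) z).hasFDerivAt
  have h1 := (hU.dt.differentiable (by simp) z).hasFDerivAt
  have h2 := fun k => ((hU.dx k).differentiable (by simp) z).hasFDerivAt
  have h := (((h1.pow 2).const_mul (1 / 2)).sub ((HasFDerivAt.fun_sum
    fun k (_ : k ∈ Finset.univ) => (h2 k).pow 2).const_mul (1 / 2))).sub
    ((h0.pow 6).const_mul (1 / 6))
  have h' : HasFDerivAt (prD U) _ z := h
  rw [h'.fderiv]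
  simp [Fin.sum_univ_three]
  ring

theorem fderiv_mul_apply {f g : ℝ × E3 → ℝ} (hf : ContDiff ℝ (⊤ : ℕ∞) f)
    (hg : ContDiff ℝ (⊤ : ℕ∞) g) (z v : ℝ × E3) :
    fderiv ℝ (fun z => f z * g z) z v = f z * fderiv ℝ g z v + fderiv ℝ f z v * g z := by
  have h : HasFDerivAt (fun z => f z * g z) _ z :=
    (hf.differentiable (by simp) z).hasFDerivAt.mul (hg.differentiable (by simp) z).hasFDerivAt
  rw [h.fderiv]
  simp [mul_comm]

theorem fderiv_neg_mul_apply {f g : ℝ × E3 → ℝ} (hf : ContDiff ℝ (⊤ : ℕ∞) f)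
    (hg : ContDiff ℝ (⊤ : ℕ∞) g) (z v : ℝ × E3) :
    fderiv ℝ (fun z => -(f z * g z)) z v =
      -(f z * fderiv ℝ g z v + fderiv ℝ f z v * g z) := by
  have h : HasFDerivAt (fun z => -(f z * g z)) _ z :=
    ((hf.differentiable (by simp) z).hasFDerivAt.mul
      (hg.differentiable (by simp) z).hasFDerivAt).neg
  rw [h.fderiv]
  simp [mul_comm]

theorem fderiv_stD (hU : ContDiff ℝ (⊤ : ℕ∞) U) (j k : Fin 3) (z v : ℝ × E3) :
    fderiv ℝ (stD U j k) z v = dx j U z * fderiv ℝ (dx k U) z v +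
      fderiv ℝ (dx j U) z v * dx k U z + if k = j then fderiv ℝ (prD U) z v else 0 := by
  have e : stD U j k = fun z => (dx j U z * dx k U z) + if k = j then prD U z else 0 := rfl
  rw [e]
  split_ifs
  · rw [fderiv_fun_add (((hU.dx j).mul (hU.dx k)).differentiable (by simp) z)
      ((contDiff_prD hU).differentiable (by simp) z)]
    simp [fderiv_mul_apply (hU.dx j) (hU.dx k)]
  · simp [fderiv_mul_apply (hU.dx j) (hU.dx k)]

/-- Conservation of energy. -/
theorem dt_enD (hU : ContDiff ℝ (⊤ : ℕ∞) U)
    (hpde : ∀ z, dt (dt U) z = ∑ k, dx k (dx k U) z - U z ^ 5) (z : ℝ × E3) :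
    dt (enD U) z + ∑ k, dx k (moD U k) z = 0 := by
  have h1 : dt (enD U) z = dt U z * dt (dt U) z + ∑ k, dx k U z * dt (dx k U) z +
    U z ^ 5 * dt U z := fderiv_enD hU z (1, 0)
  have h2 : ∀ k, dx k (moD U k) z = -(dt U z * dx k (dx k U) z + dx k (dt U) z * dx k U z) :=
    fun k => fderiv_neg_mul_apply hU.dt (hU.dx k) z (0, EuclideanSpace.single k 1)
  have h3 := hpde z
  have h4 := fun k => dx_dt_comm hU k z
  simp only [h1, h2, h3, h4, Fin.sum_univ_three]
  ring

/-- Conservation of momentum. -/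
theorem dt_moD (hU : ContDiff ℝ (⊤ : ℕ∞) U)
    (hpde : ∀ z, dt (dt U) z = ∑ k, dx k (dx k U) z - U z ^ 5) (j : Fin 3) (z : ℝ × E3) :
    dt (moD U j) z + ∑ k, dx k (stD U j k) z = 0 := by
  have h1 : dt (moD U j) z = -(dt U z * dt (dx j U) z + dt (dt U) z * dx j U z) :=
    fderiv_neg_mul_apply hU.dt (hU.dx j) z (1, 0)
  have h2 : ∀ k, dx k (stD U j k) z = dx j U z * dx k (dx k U) z +
      dx k (dx j U) z * dx k U z + if k = j then dx k (prD U) z else 0 := fun k =>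
    fderiv_stD hU j k z (0, EuclideanSpace.single k 1)
  have h5 : ∀ k, dx k (prD U) z = dt U z * dx k (dt U) z -
      ∑ l, dx l U z * dx k (dx l U) z - U z ^ 5 * dx k U z := fun k =>
    fderiv_prD hU z (0, EuclideanSpace.single k 1)
  have h3 := hpde z
  have h4 := fun k => dx_dt_comm hU k z
  have h6 := fun k => dx_dx_comm hU j k z
  simp only [h1, h2, h3, h4, Finset.sum_add_distrib, Finset.sum_ite_eq', Finset.mem_univ,
    if_true, h5, h6]
  simp only [Fin.sum_univ_three]
  ring

/-- The virial identity for `u ∂ₜu`. -/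
theorem dt_virial (hU : ContDiff ℝ (⊤ : ℕ∞) U)
    (hpde : ∀ z, dt (dt U) z = ∑ k, dx k (dx k U) z - U z ^ 5) (z : ℝ × E3) :
    dt (fun z => U z * dt U z) z + ∑ k, dx k (fun z => -(U z * dx k U z)) z =
      dt U z ^ 2 - ∑ k, dx k U z ^ 2 - U z ^ 6 := by
  have h1 : dt (fun z => U z * dt U z) z = U z * dt (dt U) z + dt U z * dt U z :=
    fderiv_mul_apply hU hU.dt z (1, 0)
  have h2 : ∀ k, dx k (fun z => -(U z * dx k U z)) z =
      -(U z * dx k (dx k U) z + dx k U z * dx k U z) := fun k =>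
    fderiv_neg_mul_apply hU (hU.dx k) z (0, EuclideanSpace.single k 1)
  simp only [h1, h2, hpde z, Fin.sum_univ_three]
  ring

end Conservation

set_option maxHeartbeats 1600000 in
/-- The pointwise error bound and coercivity for the localized interaction virial identity. -/
theorem interaction_pointwise {χ Φ X B L r a c a' c' : ℝ} {h g z D D' : E3}
    (hχ0 : 0 ≤ χ) (hχ1 : χ ≤ 1) (hΦ : 0 ≤ Φ) (hh : ‖h‖ ≤ X) (hr : 0 < r) (hz : ‖z‖ ≤ r)
    (hL : r * Φ ≤ L) (hB : r * ‖g‖ ≤ B) {e e' ℓ' : ℝ}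
    (he : e = 1 / 2 * a ^ 2 + 1 / 2 * ‖D‖ ^ 2 + 1 / 6 * c ^ 6)
    (he' : e' = 1 / 2 * a' ^ 2 + 1 / 2 * ‖D'‖ ^ 2 + 1 / 6 * c' ^ 6)
    (hℓ' : ℓ' = 1 / 2 * a' ^ 2 - 1 / 2 * ‖D'‖ ^ 2 - 1 / 6 * c' ^ 6) :
    a * inner ℝ h D * Φ * (a' * inner ℝ z D') + χ * Φ * (a * a' * inner ℝ D D') +
      χ * (a * inner ℝ g D) * (a' * inner ℝ z D') -
      χ * e * (Φ * (‖D'‖ ^ 2 + 3 * ℓ') + inner ℝ z D' * inner ℝ g D' + inner ℝ z g * ℓ') -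
      (a * inner ℝ h D * Φ + χ * (a * inner ℝ g D)) * (c' * a') +
      χ * inner ℝ g D' * e * c' + χ * Φ * e * (a' ^ 2 - ‖D'‖ ^ 2 - c' ^ 6) ≤
    -(3 / 4) * (χ * ((1 / 2 * (‖D‖ - |a|) ^ 2 + 1 / 6 * c ^ 6) * Φ *
      (1 / 2 * a' ^ 2 + 1 / 2 * ‖D'‖ ^ 2 + 2 / 3 * c' ^ 6))) +
      (6 * B + 2 * X * L) * (e * (e' + c' ^ 2 / r ^ 2)) := by
  have hc6 : 0 ≤ c ^ 6 := by positivity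
  have hc6' : 0 ≤ c' ^ 6 := by positivity
  have he0 : 0 ≤ e := by rw [he]; positivity
  have he0' : 0 ≤ e' := by rw [he']; positivity
  have hX : 0 ≤ X := (norm_nonneg _).trans hh
  have hL0 : 0 ≤ L := le_trans (by positivity) hL
  have hB0 : 0 ≤ B := le_trans (by positivity) hB
  have cs : ∀ v w : E3, |inner ℝ v w| ≤ ‖v‖ * ‖w‖ := abs_real_inner_le_norm
  have haD : |a| * ‖D‖ ≤ e := by
    rw [he]; nlinarith [sq_nonneg (|a| - ‖D‖), sq_abs a]
  have haD' : |a'| * ‖D'‖ ≤ 1 / 2 * a' ^ 2 + 1 / 2 * ‖D'‖ ^ 2 := by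
    nlinarith [sq_nonneg (|a'| - ‖D'‖), sq_abs a']
  have haDe' : |a'| * ‖D'‖ ≤ e' := by rw [he']; linarith
  set H := e' + c' ^ 2 / r ^ 2 with hH
  have hcr : c' ^ 2 / r ^ 2 = (|c'| / r) ^ 2 := by rw [div_pow, sq_abs]
  have hH0 : 0 ≤ H := by positivity
  have heH : e' ≤ H := by rw [hH]; linarith [show 0 ≤ c' ^ 2 / r ^ 2 by positivity]
  have hca : |c'| / r * |a'| ≤ H := by
    rw [hH, hcr, he']
    nlinarith [sq_nonneg (|c'| / r - |a'|), sq_abs a', sq_nonneg ‖D'‖, sq_nonneg (|c'| / r)]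
  have hcD : |c'| / r * ‖D'‖ ≤ H := by
    rw [hH, hcr, he']
    nlinarith [sq_nonneg (|c'| / r - ‖D'‖), sq_nonneg a', sq_nonneg (|c'| / r)]
  have hD2 : ‖D'‖ ^ 2 ≤ 2 * e' := by rw [he']; nlinarith [sq_nonneg a']
  have hℓ : |ℓ'| ≤ e' := by
    rw [hℓ', he', abs_le]; constructor <;> nlinarith [sq_nonneg a', sq_nonneg ‖D'‖]
  have hzg : ‖z‖ * ‖g‖ ≤ B := (mul_le_mul_of_nonneg_right hz (norm_nonneg _)).trans hB
  have hzΦ : ‖z‖ * Φ ≤ L := (mul_le_mul_of_nonneg_right hz hΦ).trans hL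
  -- the six error terms
  have E1 : a * inner ℝ h D * Φ * (a' * inner ℝ z D') ≤ X * L * (e * H) := by
    calc _ ≤ |a * inner ℝ h D * Φ * (a' * inner ℝ z D')| := le_abs_self _
      _ = |a| * |inner ℝ h D| * Φ * (|a'| * |inner ℝ z D'|) := by
        simp only [abs_mul, abs_of_nonneg hΦ]
      _ ≤ |a| * (‖h‖ * ‖D‖) * Φ * (|a'| * (‖z‖ * ‖D'‖)) := by
        gcongr <;> exact cs _ _
      _ = ‖h‖ * (‖z‖ * Φ) * ((|a| * ‖D‖) * (|a'| * ‖D'‖)) := by ring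
      _ ≤ X * L * (e * H) := by gcongr; exact haDe'.trans heH
  have E2 : χ * (a * inner ℝ g D) * (a' * inner ℝ z D') ≤ B * (e * H) := by
    calc _ ≤ |χ * (a * inner ℝ g D) * (a' * inner ℝ z D')| := le_abs_self _
      _ = χ * (|a| * |inner ℝ g D|) * (|a'| * |inner ℝ z D'|) := by
        simp only [abs_mul, abs_of_nonneg hχ0]
      _ ≤ 1 * (|a| * (‖g‖ * ‖D‖)) * (|a'| * (‖z‖ * ‖D'‖)) := by
        gcongr <;> exact cs _ _
      _ = (‖z‖ * ‖g‖) * ((|a| * ‖D‖) * (|a'| * ‖D'‖)) := by ring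
      _ ≤ B * (e * H) := by gcongr; exact haDe'.trans heH
  have E3a : -(χ * e * (inner ℝ z D' * inner ℝ g D')) ≤ 2 * B * (e * H) := by
    calc _ ≤ |-(χ * e * (inner ℝ z D' * inner ℝ g D'))| := le_abs_self _
      _ = χ * e * (|inner ℝ z D'| * |inner ℝ g D'|) := by
        simp only [abs_neg, abs_mul, abs_of_nonneg hχ0, abs_of_nonneg he0]
      _ ≤ 1 * e * ((‖z‖ * ‖D'‖) * (‖g‖ * ‖D'‖)) := by
        gcongr <;> exact cs _ _
      _ = (‖z‖ * ‖g‖) * (e * ‖D'‖ ^ 2) := by ring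
      _ ≤ B * (e * (2 * H)) := by gcongr; linarith
      _ = _ := by ring
  have E3b : -(χ * e * (inner ℝ z g * ℓ')) ≤ B * (e * H) := by
    calc _ ≤ |-(χ * e * (inner ℝ z g * ℓ'))| := le_abs_self _
      _ = χ * e * (|inner ℝ z g| * |ℓ'|) := by
        simp only [abs_neg, abs_mul, abs_of_nonneg hχ0, abs_of_nonneg he0]
      _ ≤ 1 * e * ((‖z‖ * ‖g‖) * |ℓ'|) := by
        gcongr; exact cs _ _
      _ = (‖z‖ * ‖g‖) * (e * |ℓ'|) := by ring
      _ ≤ B * (e * H) := by gcongr; linarith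
  have E4 : -(a * inner ℝ h D * Φ * (c' * a')) ≤ X * L * (e * H) := by
    calc _ ≤ |-(a * inner ℝ h D * Φ * (c' * a'))| := le_abs_self _
      _ = |a| * |inner ℝ h D| * Φ * (|c'| * |a'|) := by
        simp only [abs_neg, abs_mul, abs_of_nonneg hΦ]
      _ ≤ |a| * (‖h‖ * ‖D‖) * Φ * (|c'| * |a'|) := by
        gcongr; exact cs _ _
      _ = ‖h‖ * (r * Φ) * ((|a| * ‖D‖) * (|c'| / r * |a'|)) := by field_simp
      _ ≤ X * L * (e * H) := by gcongr
  have E5 : -(χ * (a * inner ℝ g D) * (c' * a')) ≤ B * (e * H) := by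
    calc _ ≤ |-(χ * (a * inner ℝ g D) * (c' * a'))| := le_abs_self _
      _ = χ * (|a| * |inner ℝ g D|) * (|c'| * |a'|) := by
        simp only [abs_neg, abs_mul, abs_of_nonneg hχ0]
      _ ≤ 1 * (|a| * (‖g‖ * ‖D‖)) * (|c'| * |a'|) := by
        gcongr; exact cs _ _
      _ = (r * ‖g‖) * ((|a| * ‖D‖) * (|c'| / r * |a'|)) := by field_simp
      _ ≤ B * (e * H) := by gcongr
  have E6 : χ * inner ℝ g D' * e * c' ≤ B * (e * H) := by
    calc _ ≤ |χ * inner ℝ g D' * e * c'| := le_abs_self _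
      _ = χ * |inner ℝ g D'| * e * |c'| := by
        simp only [abs_mul, abs_of_nonneg hχ0, abs_of_nonneg he0]
      _ ≤ 1 * (‖g‖ * ‖D'‖) * e * |c'| := by
        gcongr; exact cs _ _
      _ = (r * ‖g‖) * (e * (|c'| / r * ‖D'‖)) := by field_simp
      _ ≤ B * (e * H) := by gcongr
  -- the main term
  set m := 1 / 2 * a' ^ 2 + 1 / 2 * ‖D'‖ ^ 2 + 1 / 2 * c' ^ 6 with hm
  have hm0 : 0 ≤ m := by positivity
  have hPP : a * a' * inner ℝ D D' ≤ |a| * ‖D‖ * m := by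
    calc _ ≤ |a * a' * inner ℝ D D'| := le_abs_self _
      _ = |a| * |a'| * |inner ℝ D D'| := by simp only [abs_mul]
      _ ≤ |a| * |a'| * (‖D‖ * ‖D'‖) := by gcongr; exact cs _ _
      _ = |a| * ‖D‖ * (|a'| * ‖D'‖) := by ring
      _ ≤ |a| * ‖D‖ * m := by gcongr; rw [hm]; linarith
  have hq : e - |a| * ‖D‖ = 1 / 2 * (‖D‖ - |a|) ^ 2 + 1 / 6 * c ^ 6 := by
    rw [he, ← sq_abs a]; ring
  set q := 1 / 2 * (‖D‖ - |a|) ^ 2 + 1 / 6 * c ^ 6 with hqd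
  have hq0 : 0 ≤ q := by positivity
  have hmq : 3 / 4 * (1 / 2 * a' ^ 2 + 1 / 2 * ‖D'‖ ^ 2 + 2 / 3 * c' ^ 6) ≤ m := by
    rw [hm]; nlinarith [sq_nonneg a', sq_nonneg ‖D'‖]
  have M1 : a * a' * inner ℝ D D' - e * m ≤
      -(q * (3 / 4 * (1 / 2 * a' ^ 2 + 1 / 2 * ‖D'‖ ^ 2 + 2 / 3 * c' ^ 6))) := by
    have := mul_le_mul_of_nonneg_left hmq hq0
    have h3 : q * m = e * m - |a| * ‖D‖ * m := by rw [← hq]; ring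
    linarith
  have M2 := mul_le_mul_of_nonneg_left M1 (mul_nonneg hχ0 hΦ)
  have e3 : ‖D'‖ ^ 2 + 3 * ℓ' - (a' ^ 2 - ‖D'‖ ^ 2 - c' ^ 6) = m := by rw [hℓ', hm]; ring
  have key : χ * Φ * (a * a' * inner ℝ D D') - χ * e * (Φ * (‖D'‖ ^ 2 + 3 * ℓ')) +
      χ * Φ * e * (a' ^ 2 - ‖D'‖ ^ 2 - c' ^ 6) =
      χ * Φ * (a * a' * inner ℝ D D' - e * m) := by rw [← e3]; ring
  linarith

theorem interaction_boundary_pointwise {χ Φ L r a' c' e : ℝ} {z D' : E3}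
    (hχ0 : 0 ≤ χ) (hχ1 : χ ≤ 1) (hΦ : 0 ≤ Φ) (hr : 0 < r) (hz : ‖z‖ ≤ r)
    (hL : r * Φ ≤ L) (he0 : 0 ≤ e) {e' : ℝ}
    (he' : e' = 1 / 2 * a' ^ 2 + 1 / 2 * ‖D'‖ ^ 2 + 1 / 6 * c' ^ 6) :
    |χ * Φ * e * (c' * a') - χ * Φ * e * (a' * inner ℝ z D')| ≤
      2 * L * (e * (e' + c' ^ 2 / r ^ 2)) := by
  have hc6' : 0 ≤ c' ^ 6 := by positivity
  have hL0 : 0 ≤ L := le_trans (by positivity) hL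
  have hcr : c' ^ 2 / r ^ 2 = (|c'| / r) ^ 2 := by rw [div_pow, sq_abs]
  set H := e' + c' ^ 2 / r ^ 2 with hH
  have haD' : |a'| * ‖D'‖ ≤ H := by
    rw [hH, hcr, he']
    nlinarith [sq_nonneg (|a'| - ‖D'‖), sq_abs a', sq_nonneg (|c'| / r)]
  have hca : |c'| / r * |a'| ≤ H := by
    rw [hH, hcr, he']
    nlinarith [sq_nonneg (|c'| / r - |a'|), sq_abs a', sq_nonneg ‖D'‖, sq_nonneg (|c'| / r)]
  have hzΦ : ‖z‖ * Φ ≤ L := (mul_le_mul_of_nonneg_right hz hΦ).trans hL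
  have E1 : |χ * Φ * e * (c' * a')| ≤ L * (e * H) := by
    calc _ = χ * Φ * e * (|c'| * |a'|) := by
          simp only [abs_mul, abs_of_nonneg hχ0, abs_of_nonneg hΦ, abs_of_nonneg he0]
      _ ≤ 1 * Φ * e * (|c'| * |a'|) := by gcongr
      _ = (r * Φ) * (e * (|c'| / r * |a'|)) := by field_simp
      _ ≤ L * (e * H) := by gcongr
  have E2 : |χ * Φ * e * (a' * inner ℝ z D')| ≤ L * (e * H) := by
    calc _ = χ * Φ * e * (|a'| * |inner ℝ z D'|) := by
          simp only [abs_mul, abs_of_nonneg hχ0, abs_of_nonneg hΦ, abs_of_nonneg he0]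
      _ ≤ 1 * Φ * e * (|a'| * (‖z‖ * ‖D'‖)) := by gcongr; exact abs_real_inner_le_norm _ _
      _ = (‖z‖ * Φ) * (e * (|a'| * ‖D'‖)) := by ring
      _ ≤ L * (e * H) := by gcongr
  rw [abs_le] at E1 E2 ⊢
  constructor <;> linarith [E1.1, E1.2, E2.1, E2.2]

theorem gradient_apply (f : E3 → ℝ) (x : E3) (k : Fin 3) :
    gradient f x k = fderiv ℝ f x (EuclideanSpace.single k 1) := by
  have h : inner ℝ (gradient f x) (EuclideanSpace.single k (1 : ℝ)) =
      fderiv ℝ f x (EuclideanSpace.single k 1) := by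
    rw [gradient]; exact InnerProductSpace.toDual_symm_apply
  rw [← h, EuclideanSpace.inner_single_right]
  simp

theorem norm_gradient (f : E3 → ℝ) (x : E3) : ‖gradient f x‖ = ‖fderiv ℝ f x‖ :=
  LinearIsometryEquiv.norm_map _ _

/-- The spatial gradient of a function on spacetime. -/
def gr (U : ℝ × E3 → ℝ) (z : ℝ × E3) : E3 := WithLp.toLp 2 fun k => dx k U z

theorem norm_gr_sq (U : ℝ × E3 → ℝ) (z : ℝ × E3) : ‖gr U z‖ ^ 2 = ∑ k, dx k U z ^ 2 := by
  simp [gr, EuclideanSpace.norm_sq_eq]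

/-- The coercive energy density. -/
def qD (U : ℝ × E3 → ℝ) (z : ℝ × E3) : ℝ :=
  1 / 2 * (‖gr U z‖ - |dt U z|) ^ 2 + 1 / 6 * U z ^ 6

/-- The energy density with a larger potential term. -/
def pD (U : ℝ × E3 → ℝ) (z : ℝ × E3) : ℝ :=
  1 / 2 * dt U z ^ 2 + 1 / 2 * ‖gr U z‖ ^ 2 + 2 / 3 * U z ^ 6

/-- The interaction energy density with regularized Hardy term. -/
def hD (U : ℝ × E3 → ℝ) (ε t : ℝ) (w : E3 × E3) : ℝ :=
  enD U (t, w.1) * (enD U (t, w.2) + U (t, w.2) ^ 2 / (‖w.1 - w.2‖ ^ 2 + ε))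

theorem enD_nonneg (U : ℝ × E3 → ℝ) (z : ℝ × E3) : 0 ≤ enD U z := by
  unfold enD; positivity

theorem enD_eq (U : ℝ × E3 → ℝ) (z : ℝ × E3) :
    enD U z = 1 / 2 * dt U z ^ 2 + 1 / 2 * ‖gr U z‖ ^ 2 + 1 / 6 * U z ^ 6 := by
  rw [norm_gr_sq, enD]

theorem contDiff_kernel {χ Ψ : E3 → ℝ} (hχ : ContDiff ℝ (⊤ : ℕ∞) χ)
    (hΨ : ContDiff ℝ (⊤ : ℕ∞) Ψ) :
    ContDiff ℝ (⊤ : ℕ∞) fun w : E3 × E3 => χ w.1 * Ψ (w.1 - w.2) :=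
  (hχ.comp contDiff_fst).mul (hΨ.comp (contDiff_fst.sub contDiff_snd))

theorem hasCompactSupport_kernel {χ Ψ : E3 → ℝ} (hχ : HasCompactSupport χ)
    (hΨ : HasCompactSupport Ψ) :
    HasCompactSupport fun w : E3 × E3 => χ w.1 * Ψ (w.1 - w.2) := by
  have hK : IsCompact ((fun w : E3 × E3 => (w.1, w.1 - w.2)) '' (tsupport χ ×ˢ tsupport Ψ)) :=
    (IsCompact.prod hχ hΨ).image (by fun_prop)
  refine HasCompactSupport.of_support_subset_isCompact hK fun w hw => ?_
  have hw' : χ w.1 * Ψ (w.1 - w.2) ≠ 0 := hw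
  exact ⟨(w.1, w.1 - w.2), ⟨subset_tsupport _ (left_ne_zero_of_mul hw'),
    subset_tsupport _ (right_ne_zero_of_mul hw')⟩, by simp⟩

theorem fderiv_kernel {χ Ψ : E3 → ℝ} (hχ : ContDiff ℝ (⊤ : ℕ∞) χ)
    (hΨ : ContDiff ℝ (⊤ : ℕ∞) Ψ) (w v : E3 × E3) :
    fderiv ℝ (fun w : E3 × E3 => χ w.1 * Ψ (w.1 - w.2)) w v =
      fderiv ℝ χ w.1 v.1 * Ψ (w.1 - w.2) + χ w.1 * fderiv ℝ Ψ (w.1 - w.2) (v.1 - v.2) := by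
  have h1 : HasFDerivAt (fun w : E3 × E3 => χ w.1) _ w :=
    ((hχ.differentiable (by simp) w.1).hasFDerivAt).comp w hasFDerivAt_fst
  have h2 : HasFDerivAt (fun w : E3 × E3 => Ψ (w.1 - w.2)) _ w :=
    ((hΨ.differentiable (by simp) (w.1 - w.2)).hasFDerivAt).comp w
      (hasFDerivAt_fst.sub hasFDerivAt_snd)
  have h : HasFDerivAt (fun w : E3 × E3 => χ w.1 * Ψ (w.1 - w.2)) _ w := h1.mul h2
  rw [h.fderiv]
  simp [mul_comm, add_comm]

theorem contDiff_coord_mul {Φ : E3 → ℝ} (hΦ : ContDiff ℝ (⊤ : ℕ∞) Φ) (j : Fin 3) :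
    ContDiff ℝ (⊤ : ℕ∞) fun z : E3 => z j * Φ z :=
  (EuclideanSpace.proj (𝕜 := ℝ) j).contDiff.mul hΦ

theorem fderiv_coord_mul {Φ : E3 → ℝ} (hΦ : ContDiff ℝ (⊤ : ℕ∞) Φ) (j : Fin 3) (z v : E3) :
    fderiv ℝ (fun z : E3 => z j * Φ z) z v = v j * Φ z + z j * fderiv ℝ Φ z v := by
  have h1 : HasFDerivAt (fun z : E3 => z j) _ z :=
    (EuclideanSpace.proj (𝕜 := ℝ) (ι := Fin 3) j).hasFDerivAt
  have h : HasFDerivAt (fun z : E3 => z j * Φ z) _ z :=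
    h1.mul (hΦ.differentiable (by simp) z).hasFDerivAt
  rw [h.fderiv]
  simp [mul_comm, add_comm]

section Interaction

variable {U : ℝ × E3 → ℝ}

theorem interaction_integrand_eq {χ Φ : E3 → ℝ} (hχ : ContDiff ℝ (⊤ : ℕ∞) χ)
    (hΦ : ContDiff ℝ (⊤ : ℕ∞) Φ) (t : ℝ) (w : E3 × E3) :
    (∑ k, (fderiv ℝ (fun w : E3 × E3 => χ w.1 * Φ (w.1 - w.2)) w (EuclideanSpace.single k 1, 0) *
        (moD U k (t, w.1) * (U (t, w.2) * dt U (t, w.2))) +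
      fderiv ℝ (fun w : E3 × E3 => χ w.1 * Φ (w.1 - w.2)) w (0, EuclideanSpace.single k 1) *
        (enD U (t, w.1) * -(U (t, w.2) * dx k U (t, w.2))))) +
      χ w.1 * Φ (w.1 - w.2) * (enD U (t, w.1) *
        (dt U (t, w.2) ^ 2 - ∑ k, dx k U (t, w.2) ^ 2 - U (t, w.2) ^ 6)) +
    ∑ j, ∑ k, (fderiv ℝ (fun w : E3 × E3 => χ w.1 * ((w.1 - w.2) j * Φ (w.1 - w.2))) w
        (EuclideanSpace.single k 1, 0) * (moD U k (t, w.1) * moD U j (t, w.2)) +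
      fderiv ℝ (fun w : E3 × E3 => χ w.1 * ((w.1 - w.2) j * Φ (w.1 - w.2))) w
        (0, EuclideanSpace.single k 1) * (enD U (t, w.1) * stD U j k (t, w.2))) =
    dt U (t, w.1) * inner ℝ (gradient χ w.1) (gr U (t, w.1)) * Φ (w.1 - w.2) *
        (dt U (t, w.2) * inner ℝ (w.1 - w.2) (gr U (t, w.2))) +
      χ w.1 * Φ (w.1 - w.2) * (dt U (t, w.1) * dt U (t, w.2) *
        inner ℝ (gr U (t, w.1)) (gr U (t, w.2))) +
      χ w.1 * (dt U (t, w.1) * inner ℝ (gradient Φ (w.1 - w.2)) (gr U (t, w.1))) *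
        (dt U (t, w.2) * inner ℝ (w.1 - w.2) (gr U (t, w.2))) -
      χ w.1 * enD U (t, w.1) * (Φ (w.1 - w.2) * (‖gr U (t, w.2)‖ ^ 2 + 3 * prD U (t, w.2)) +
        inner ℝ (w.1 - w.2) (gr U (t, w.2)) *
          inner ℝ (gradient Φ (w.1 - w.2)) (gr U (t, w.2)) +
        inner ℝ (w.1 - w.2) (gradient Φ (w.1 - w.2)) * prD U (t, w.2)) -
      (dt U (t, w.1) * inner ℝ (gradient χ w.1) (gr U (t, w.1)) * Φ (w.1 - w.2) +
        χ w.1 * (dt U (t, w.1) * inner ℝ (gradient Φ (w.1 - w.2)) (gr U (t, w.1)))) *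
        (U (t, w.2) * dt U (t, w.2)) +
      χ w.1 * inner ℝ (gradient Φ (w.1 - w.2)) (gr U (t, w.2)) * enD U (t, w.1) * U (t, w.2) +
      χ w.1 * Φ (w.1 - w.2) * enD U (t, w.1) *
        (dt U (t, w.2) ^ 2 - ‖gr U (t, w.2)‖ ^ 2 - U (t, w.2) ^ 6) := by
  simp only [norm_gr_sq]
  simp only [fderiv_kernel hχ hΦ, fderiv_kernel hχ (contDiff_coord_mul hΦ _),
    fderiv_coord_mul hΦ, PiLp.inner_apply, Fin.sum_univ_three, gradient_apply,
    RCLike.inner_apply, conj_trivial, moD, stD, gr, sub_zero, zero_sub, map_neg, map_zero]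
  generalize w.1 - w.2 = z
  generalize enD U (t, w.1) = e
  generalize prD U (t, w.2) = l
  simp
  ring

/-- The localized interaction functional has bounded size, and its derivative controls the
interaction of the coercive density with the energy density. -/
theorem exists_interaction_functional (hU : ContDiff ℝ (⊤ : ℕ∞) U)
    (hpde : ∀ z, dt (dt U) z = ∑ k, dx k (dx k U) z - U z ^ 5) {χ Φ : E3 → ℝ}
    (hχ : ContDiff ℝ (⊤ : ℕ∞) χ) (hχc : HasCompactSupport χ)
    (hΦ : ContDiff ℝ (⊤ : ℕ∞) Φ) (hΦc : HasCompactSupport Φ) {X B L ε A : ℝ}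
    (hχ0 : ∀ x, 0 ≤ χ x) (hχ1 : ∀ x, χ x ≤ 1) (hX : ∀ x, ‖fderiv ℝ χ x‖ ≤ X)
    (hΦ0 : ∀ x, 0 ≤ Φ x) (hε : 0 < ε) (hL : ∀ x, √(‖x‖ ^ 2 + ε) * Φ x ≤ L)
    (hB : ∀ x, √(‖x‖ ^ 2 + ε) * ‖fderiv ℝ Φ x‖ ≤ B)
    (hH : ∀ t, Integrable (hD U ε t)) (hA : ∀ t, ∫ w, hD U ε t w ≤ A)
    (hQ : ∀ t, Integrable fun w : E3 × E3 =>
      χ w.1 * (qD U (t, w.1) * Φ (w.1 - w.2) * pD U (t, w.2))) :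
    ∃ M M' : ℝ → ℝ, (∀ t, HasDerivAt M (M' t) t) ∧ (∀ t, |M t| ≤ 2 * L * A) ∧
      ∀ t, M' t ≤ -(3 / 4) * (∫ w : E3 × E3,
        χ w.1 * (qD U (t, w.1) * Φ (w.1 - w.2) * pD U (t, w.2))) + (6 * B + 2 * X * L) * A := by
  have hX0 : 0 ≤ X := (norm_nonneg _).trans (hX 0)
  have hL0 : 0 ≤ L := le_trans (mul_nonneg (sqrt_nonneg _) (hΦ0 _)) (hL 0)
  have hB0 : 0 ≤ B := le_trans (by positivity) (hB 0)
  have hr : ∀ z : E3, 0 < √(‖z‖ ^ 2 + ε) := fun z => sqrt_pos.2 (by positivity)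
  have hzr : ∀ z : E3, ‖z‖ ≤ √(‖z‖ ^ 2 + ε) := fun z => le_sqrt_of_sq_le (by linarith)
  have hr2 : ∀ z : E3, √(‖z‖ ^ 2 + ε) ^ 2 = ‖z‖ ^ 2 + ε := fun z => sq_sqrt (by positivity)
  have key := fun t => hasDerivAt_interaction (ι := Option (Fin 3))
    (K := fun i => i.elim (fun w : E3 × E3 => χ w.1 * Φ (w.1 - w.2))
      fun j w => χ w.1 * ((w.1 - w.2) j * Φ (w.1 - w.2)))
    (ρ := enD U) (j := moD U)
    (σ := fun i => i.elim (fun z => U z * dt U z) (moD U))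
    (s := fun i => i.elim (fun z => dt U z ^ 2 - ∑ k, dx k U z ^ 2 - U z ^ 6) fun _ _ => 0)
    (J := fun i => i.elim (fun k z => -(U z * dx k U z)) (stD U))
    (by
      rintro (_ | j)
      · exact contDiff_kernel hχ hΦ
      · exact contDiff_kernel hχ (contDiff_coord_mul hΦ j))
    (by
      rintro (_ | j)
      · exact hasCompactSupport_kernel hχc hΦc
      · exact hasCompactSupport_kernel hχc (Ψ := fun z : E3 => z j * Φ z) hΦc.mul_left)
    (contDiff_enD hU)
    (by
      rintro (_ | j)
      · exact hU.mul hU.dt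
      · exact contDiff_moD hU j)
    (by
      rintro (_ | j)
      · exact ((hU.dt.pow 2).sub (ContDiff.sum fun k _ => (hU.dx k).pow 2)).sub (hU.pow 6)
      · exact contDiff_const)
    (contDiff_moD hU)
    (by
      rintro (_ | j) k
      · exact (hU.mul (hU.dx k)).neg
      · exact contDiff_stD hU j k)
    (dt_enD hU hpde)
    (by
      rintro (_ | j) z
      · exact dt_virial hU hpde z
      · exact dt_moD hU hpde j z) t
  simp only [Fintype.sum_option, Option.elim_none, Option.elim_some, mul_zero, add_zero,
    interaction_integrand_eq hχ hΦ] at key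
  refine ⟨_, _, fun t => (key t).2.2, fun t => ?_, fun t => ?_⟩
  · have h2 : 2 * L * A ≥ ∫ w, 2 * L * hD U ε t w := by
      rw [integral_const_mul]; exact mul_le_mul_of_nonneg_left (hA t) (by positivity)
    refine le_trans ?_ h2
    rw [← norm_eq_abs]
    refine norm_integral_le_of_norm_le ((hH t).const_mul _) (.of_forall fun w => ?_)
    have := interaction_boundary_pointwise (a' := dt U (t, w.2)) (c' := U (t, w.2))
      (D' := gr U (t, w.2)) (e := enD U (t, w.1))
      (hχ0 w.1) (hχ1 w.1) (hΦ0 (w.1 - w.2)) (hr _) (hzr (w.1 - w.2)) (hL _)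
      (enD_nonneg _ _) (enD_eq U (t, w.2))
    rw [hr2] at this
    rw [norm_eq_abs]
    unfold hD
    convert this using 2
    simp only [PiLp.inner_apply, Fin.sum_univ_three, gr, moD, RCLike.inner_apply, conj_trivial]
    ring
  · have h2 : (6 * B + 2 * X * L) * A ≥ ∫ w, (6 * B + 2 * X * L) * hD U ε t w := by
      rw [integral_const_mul]; exact mul_le_mul_of_nonneg_left (hA t) (by positivity)
    refine le_trans ?_ (add_le_add_right h2 _)
    rw [← integral_const_mul, ← integral_add ((hQ t).const_mul _) ((hH t).const_mul _)]
    refine integral_mono (key t).2.1 (((hQ t).const_mul _).add ((hH t).const_mul _)) fun w => ?_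
    have := interaction_pointwise (B := B) (a := dt U (t, w.1)) (c := U (t, w.1)) (a' := dt U (t, w.2))
      (c' := U (t, w.2)) (D := gr U (t, w.1))
      (D' := gr U (t, w.2)) (e := enD U (t, w.1))
      (hχ0 w.1) (hχ1 w.1) (hΦ0 (w.1 - w.2)) ((norm_gradient χ w.1).trans_le (hX _)) (hr _)
      (hzr (w.1 - w.2)) (hL _)
      (g := gradient Φ (w.1 - w.2)) ((congrArg _ (norm_gradient Φ _)).trans_le (hB _))
      (enD_eq U _) (enD_eq U (t, w.2)) (ℓ' := prD U (t, w.2)) (by rw [norm_gr_sq, prD])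
    rw [hr2] at this
    change _ ≤ -(3 / 4) * _ + _ * hD U ε t w
    unfold hD qD pD
    exact this

end Interaction

theorem abs_coord_le_norm (z : E3) (k : Fin 3) : |z k| ≤ ‖z‖ := by
  simpa using PiLp.norm_apply_le z k

/-- A regularized Hardy inequality on `ℝ³`. -/
theorem hardy {f : E3 → ℝ} (hf : ContDiff ℝ (⊤ : ℕ∞) f) (h2 : Integrable fun y => f y ^ 2)
    (hd2 : Integrable fun y => ‖fderiv ℝ f y‖ ^ 2) {ε : ℝ} (hε : 0 < ε) (x : E3) :
    Integrable (fun y => f y ^ 2 / (‖x - y‖ ^ 2 + ε)) ∧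
    ∫ y, f y ^ 2 / (‖x - y‖ ^ 2 + ε) ≤ 4 * ∫ y, ‖fderiv ℝ f y‖ ^ 2 := by
  have hN : ∀ y : E3, 0 < ‖x - y‖ ^ 2 + ε := fun y => by positivity
  have hfc := hf.continuous
  have hdc : Continuous (fderiv ℝ f) := hf.continuous_fderiv (by simp)
  have hI : Integrable (fun y => f y ^ 2 / (‖x - y‖ ^ 2 + ε)) := by
    refine (h2.mul_const (1 / ε)).mono' (Continuous.aestronglyMeasurable
      ((hfc.pow 2).div₀ (by fun_prop) fun y => (hN y).ne')) (.of_forall fun y => ?_)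
    rw [norm_eq_abs, abs_of_nonneg (by have := hN y; positivity), div_eq_mul_one_div]
    gcongr
    nlinarith [sq_nonneg ‖x - y‖]
  refine ⟨hI, ?_⟩
  set V : Fin 3 → E3 → ℝ := fun k y => (y - x) k / (‖x - y‖ ^ 2 + ε) with hV
  set V' : Fin 3 → E3 → ℝ := fun k y => 1 / (‖x - y‖ ^ 2 + ε) -
    2 * (y - x) k ^ 2 / (‖x - y‖ ^ 2 + ε) ^ 2 with hV'
  set g : Fin 3 → E3 → ℝ := fun k y =>
    2 * f y * fderiv ℝ f y (EuclideanSpace.single k 1) * V k y + f y ^ 2 * V' k y with hg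
  have hVc : ∀ k, Continuous (V k) := fun k =>
    Continuous.div₀ (by fun_prop) (by fun_prop) fun y => (hN y).ne'
  have hVc' : ∀ k, Continuous (V' k) := fun k =>
    (Continuous.div₀ (by fun_prop) (by fun_prop) fun y => (hN y).ne').sub
      (Continuous.div₀ (by fun_prop) (by fun_prop) fun y => (pow_pos (hN y) 2).ne')
  have hVb : ∀ k y, |V k y| ≤ 1 + 1 / ε := fun k y => by
    have h := abs_coord_le_norm (y - x) k
    rw [norm_sub_rev] at h
    rw [hV, abs_div, abs_of_pos (hN y), div_le_iff₀ (hN y)]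
    have h3 : (1 + 1 / ε) * (‖x - y‖ ^ 2 + ε) =
      ‖x - y‖ ^ 2 + 1 + (ε + ‖x - y‖ ^ 2 / ε) := by field_simp; ring
    rw [h3]
    have : 0 ≤ ‖x - y‖ ^ 2 / ε := by positivity
    nlinarith [sq_nonneg (‖x - y‖ - 1)]
  have hVb' : ∀ k y, |V' k y| ≤ 3 / ε := fun k y => by
    have h := abs_coord_le_norm (y - x) k
    rw [norm_sub_rev] at h
    have h1 : (y - x) k ^ 2 ≤ ‖x - y‖ ^ 2 := by
      rw [← sq_abs]; gcongr
    have h3 : 1 / (‖x - y‖ ^ 2 + ε) ≤ 1 / ε := by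
      gcongr; nlinarith [sq_nonneg ‖x - y‖]
    have h5 : 0 ≤ 1 / (‖x - y‖ ^ 2 + ε) := by have := hN y; positivity
    have h4 : 2 * (y - x) k ^ 2 / (‖x - y‖ ^ 2 + ε) ^ 2 ≤ 2 * (1 / (‖x - y‖ ^ 2 + ε)) := by
      rw [mul_one_div, div_le_div_iff₀ (by have := hN y; positivity) (hN y)]
      have := hN y
      nlinarith [mul_nonneg this.le this.le, mul_pos hε this]
    have h6 : 0 ≤ 2 * (y - x) k ^ 2 / (‖x - y‖ ^ 2 + ε) ^ 2 := by positivity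
    have h7 : 3 / ε = 3 * (1 / ε) := by ring
    rw [hV', abs_le]
    constructor <;> simp only <;> linarith
  have hFD : ∀ k y, |fderiv ℝ f y (EuclideanSpace.single k 1)| ≤ ‖fderiv ℝ f y‖ := fun k y => by
    simpa using (fderiv ℝ f y).le_opNorm (EuclideanSpace.single k 1)
  have hFi : ∀ k, Integrable fun y => f y ^ 2 * V k y := fun k => by
    refine (h2.mul_const (1 + 1 / ε)).mono' ((hfc.pow 2).mul (hVc k)).aestronglyMeasurable
      (.of_forall fun y => ?_)
    rw [norm_eq_abs, abs_mul, abs_of_nonneg (sq_nonneg (f y))]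
    exact mul_le_mul_of_nonneg_left (hVb k y) (sq_nonneg _)
  have hgi : ∀ k, Integrable (g k) := fun k => by
    refine (((h2.add hd2).mul_const (1 + 1 / ε)).add (h2.mul_const (3 / ε))).mono' ?_
      (.of_forall fun y => ?_)
    · have := hdc.clm_apply (continuous_const (y := (EuclideanSpace.single k 1 : E3)))
      have h1 := hVc k
      have h2 := hVc' k
      exact Continuous.aestronglyMeasurable (by fun_prop)
    · refine (abs_add_le _ _).trans (add_le_add ?_ ?_)
      · rw [abs_mul]
        refine mul_le_mul ?_ (hVb k y) (abs_nonneg _)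
          (by simp only [Pi.add_apply]; positivity)
        rw [abs_mul, abs_mul, abs_two]
        have := hFD k y
        have h3 : |f y| * |fderiv ℝ f y (EuclideanSpace.single k 1)| ≤
          |f y| * ‖fderiv ℝ f y‖ := by gcongr
        simp only [Pi.add_apply]
        nlinarith [sq_nonneg (|f y| - ‖fderiv ℝ f y‖), sq_abs (f y)]
      · rw [abs_mul, abs_of_nonneg (sq_nonneg (f y))]
        exact mul_le_mul_of_nonneg_left (hVb' k y) (sq_nonneg _)
  have hz : ∀ k, ∫ y, g k y = 0 := fun k => by
    refine integral_eq_zero_of_hasLineDerivAt (v := EuclideanSpace.single k 1) (hFi k) (hgi k)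
      fun y => ?_
    have d0 : HasFDerivAt f (fderiv ℝ f y) y := (hf.differentiable (by simp) y).hasFDerivAt
    have d1 : HasFDerivAt (fun y : E3 => (y - x) k)
        (EuclideanSpace.proj (𝕜 := ℝ) (ι := Fin 3) k) y := by
      have h := (EuclideanSpace.proj (𝕜 := ℝ) (ι := Fin 3) k).hasFDerivAt (x := y)
      exact h.sub_const (x k)
    have d2 : HasFDerivAt (fun y : E3 => ‖x - y‖ ^ 2 + ε) (2 • innerSL ℝ (y - x)) y := by
      have h := ((hasFDerivAt_id y).sub_const x).norm_sq.add_const ε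
      simp only [id] at h
      simp_rw [norm_sub_rev x]
      exact h
    have d3 : HasFDerivAt (fun y => f y ^ 2 * ((y - x) k * (‖x - y‖ ^ 2 + ε)⁻¹)) _ y :=
      (d0.pow 2).mul (d1.mul (((hasDerivAt_inv (hN y).ne').comp_hasFDerivAt y d2)))
    have := d3.hasLineDerivAt (EuclideanSpace.single k 1)
    simp only [← div_eq_mul_inv] at this
    convert this using 1
    have hs : ∀ v : E3, inner ℝ v (EuclideanSpace.single k (1 : ℝ)) = v k := fun v => by
      rw [EuclideanSpace.inner_single_right]; simp
    simp [hg, hV, hV', hs]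
    have := (hN y).ne'
    field_simp
    ring
  have hsum : ∫ y, ∑ k, g k y = 0 := by
    rw [integral_finsetSum _ fun k _ => hgi k]; simp [hz]
  have hle : ∫ y, (1 / 2 * (f y ^ 2 / (‖x - y‖ ^ 2 + ε)) - 2 * ‖fderiv ℝ f y‖ ^ 2) ≤
      ∫ y, ∑ k, g k y := by
    refine integral_mono ((hI.const_mul _).sub (hd2.const_mul _))
      (integrable_finsetSum _ fun k _ => hgi k) fun y => ?_
    have hz2 : ‖x - y‖ ^ 2 = ∑ k, (y - x) k ^ 2 := by
      rw [norm_sub_rev]; simp [EuclideanSpace.norm_sq_eq]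
    have hin : ∑ k, fderiv ℝ f y (EuclideanSpace.single k 1) * (y - x) k =
        inner ℝ (y - x) (gradient f y) := by
      simp only [PiLp.inner_apply, gradient_apply, RCLike.inner_apply, conj_trivial]
    have e : ∑ k, g k y = 2 * f y * inner ℝ (y - x) (gradient f y) / (‖x - y‖ ^ 2 + ε) +
        f y ^ 2 * (3 / (‖x - y‖ ^ 2 + ε) - 2 * ‖x - y‖ ^ 2 / (‖x - y‖ ^ 2 + ε) ^ 2) := by
      have h4 : 2 * ‖x - y‖ ^ 2 / (‖x - y‖ ^ 2 + ε) ^ 2 =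
        2 * (∑ k, (y - x) k ^ 2) / (‖x - y‖ ^ 2 + ε) ^ 2 := by rw [← hz2]
      rw [← hin, h4, hg, hV, hV']
      simp only [Fin.sum_univ_three]
      ring
    simp only [e]
    have hcs := abs_real_inner_le_norm (y - x) (gradient f y)
    rw [norm_gradient, norm_sub_rev] at hcs
    set ρ := ‖x - y‖
    set I := inner ℝ (y - x) (gradient f y)
    set G := ‖fderiv ℝ f y‖
    have hNp : 0 < ρ ^ 2 + ε := by positivity
    have hI2 : I ^ 2 ≤ (ρ ^ 2 + ε) * G ^ 2 := by
      have : I ^ 2 ≤ (ρ * G) ^ 2 := by rw [← sq_abs]; gcongr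
      nlinarith [mul_nonneg hε.le (sq_nonneg G)]
    have h5 : 0 ≤ (f y + 2 * I) ^ 2 / (2 * (ρ ^ 2 + ε)) := by positivity
    have h6 : 2 * I ^ 2 / (ρ ^ 2 + ε) ≤ 2 * G ^ 2 := by
      rw [div_le_iff₀ hNp]; nlinarith
    have h7 : 0 ≤ f y ^ 2 * (2 * ε / (ρ ^ 2 + ε) ^ 2) := by positivity
    have h8 : 2 * f y * I / (ρ ^ 2 + ε) +
        f y ^ 2 * (3 / (ρ ^ 2 + ε) - 2 * ρ ^ 2 / (ρ ^ 2 + ε) ^ 2) =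
        1 / 2 * (f y ^ 2 / (ρ ^ 2 + ε)) + (f y + 2 * I) ^ 2 / (2 * (ρ ^ 2 + ε)) -
        2 * I ^ 2 / (ρ ^ 2 + ε) + f y ^ 2 * (2 * ε / (ρ ^ 2 + ε) ^ 2) := by
      field_simp; ring
    rw [h8]
    linarith
  rw [hsum, integral_sub (hI.const_mul _) (hd2.const_mul _), integral_const_mul,
    integral_const_mul] at hle
  linarith

theorem IsSchwartz.integrable_pow {f : E3 → ℝ} (hf : IsSchwartz f) {n : ℕ} (hn : n ≠ 0) :
    Integrable fun x => f x ^ (2 * n) := by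
  let g : SchwartzMap E3 ℝ := ⟨f, hf.1, hf.2⟩
  have h := (g.memLp ((2 * n : ℕ) : ℝ≥0∞) volume).integrable_norm_pow (by omega)
  refine h.congr (.of_forall fun x => ?_)
  change |f x| ^ (2 * n) = f x ^ (2 * n)
  rw [pow_mul, sq_abs, ← pow_mul]

theorem IsSchwartz.integrable_fderiv_sq {f : E3 → ℝ} (hf : IsSchwartz f) :
    Integrable fun x => ‖fderiv ℝ f x‖ ^ 2 := by
  let g : SchwartzMap E3 ℝ := ⟨f, hf.1, hf.2⟩
  have h := ((SchwartzMap.fderivCLM ℝ E3 ℝ g).memLp 2 volume).integrable_norm_pow (by simp)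
  exact h

section Bridge

variable {u : ℝ → E3 → ℝ}

theorem IsNLW.contDiff (hu : IsNLW u) : ContDiff ℝ (⊤ : ℕ∞) (uncurry u) := by
  have h := hu.1
  rwa [univ_prod_univ, contDiffOn_univ] at h

theorem tderiv_eq_dt (hU : ContDiff ℝ (⊤ : ℕ∞) (uncurry u)) (t : ℝ) (x : E3) :
    tderiv u t x = dt (uncurry u) (t, x) := (hasDerivAt_dt hU t x).deriv

theorem hasFDerivAt_slice {f : ℝ × E3 → ℝ} (hf : ContDiff ℝ (⊤ : ℕ∞) f) (t : ℝ) (x : E3) :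
    HasFDerivAt (fun y => f (t, y)) ((fderiv ℝ f (t, x)).comp (.inr ℝ ℝ E3)) x :=
  ((hf.differentiable (by simp) (t, x)).hasFDerivAt).comp x (hasFDerivAt_prodMk_right t x)

theorem fderiv_slice {f : ℝ × E3 → ℝ} (hf : ContDiff ℝ (⊤ : ℕ∞) f) (t : ℝ) (x : E3)
    (k : Fin 3) :
    fderiv ℝ (fun y => f (t, y)) x (EuclideanSpace.single k 1) = dx k f (t, x) := by
  rw [(hasFDerivAt_slice hf t x).fderiv]
  simp [dx]

theorem gradient_eq_gr (hU : ContDiff ℝ (⊤ : ℕ∞) (uncurry u)) (t : ℝ) (x : E3) :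
    gradient (u t) x = gr (uncurry u) (t, x) := by
  ext k
  rw [gradient_apply]
  exact fderiv_slice hU t x k

theorem lap_eq_dx (hU : ContDiff ℝ (⊤ : ℕ∞) (uncurry u)) (t : ℝ) (x : E3) :
    lap (u t) x = ∑ k, dx k (dx k (uncurry u)) (t, x) := by
  unfold lap
  refine Finset.sum_congr rfl fun k _ => ?_
  rw [iteratedFDeriv_two_apply]
  have h1 : ContDiff ℝ (⊤ : ℕ∞) (u t) := hU.comp (contDiff_prodMk_right t)
  have h2 : DifferentiableAt ℝ (fderiv ℝ (u t)) x :=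
    (h1.fderiv_right (m := (⊤ : ℕ∞)) (by simp)).differentiable (by simp) x
  have h3 := (h2.hasFDerivAt.clm_apply (hasFDerivAt_const (EuclideanSpace.single k 1 : E3) x))
  have h4 : fderiv ℝ (fun y => fderiv ℝ (u t) y (EuclideanSpace.single k 1)) x
      (EuclideanSpace.single k 1) =
      fderiv ℝ (fderiv ℝ (u t)) x (EuclideanSpace.single k 1) (EuclideanSpace.single k 1) := by
    rw [h3.fderiv]; simp
  have h5 : (fun y => fderiv ℝ (u t) y (EuclideanSpace.single k 1)) =
      fun y => dx k (uncurry u) (t, y) := funext fun y => fderiv_slice hU t y k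
  rw [h5, fderiv_slice (hU.dx k)] at h4
  simpa using h4.symm

theorem IsNLW.dt_dt (hu : IsNLW u) (z : ℝ × E3) :
    dt (dt (uncurry u)) z = ∑ k, dx k (dx k (uncurry u)) z - uncurry u z ^ 5 := by
  obtain ⟨t, x⟩ := z
  have hU := hu.contDiff
  have h := hu.2.2 t (mem_univ t) x
  have h2 : tderiv2 u t x = dt (dt (uncurry u)) (t, x) := by
    unfold tderiv2
    simp_rw [tderiv_eq_dt hU]
    exact (hasDerivAt_dt hU.dt t x).deriv
  rw [h2, lap_eq_dx hU] at h
  simp only [uncurry_apply_pair]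
  linarith

theorem IsNLW.integrable_sq (hu : IsNLW u) (t : ℝ) :
    Integrable fun x => uncurry u (t, x) ^ 2 :=
  (hu.2.1 t (mem_univ t)).1.integrable_pow one_ne_zero

theorem IsNLW.integrable_pow_six (hu : IsNLW u) (t : ℝ) :
    Integrable fun x => uncurry u (t, x) ^ 6 :=
  (hu.2.1 t (mem_univ t)).1.integrable_pow three_ne_zero

theorem IsNLW.integrable_dt_sq (hu : IsNLW u) (t : ℝ) :
    Integrable fun x => dt (uncurry u) (t, x) ^ 2 := by
  have h := (hu.2.1 t (mem_univ t)).2.integrable_pow one_ne_zero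
  simpa only [tderiv_eq_dt hu.contDiff, mul_one] using h

theorem IsNLW.integrable_gr_sq (hu : IsNLW u) (t : ℝ) :
    Integrable fun x => ‖gr (uncurry u) (t, x)‖ ^ 2 := by
  have h := (hu.2.1 t (mem_univ t)).1.integrable_fderiv_sq
  simpa only [← norm_gradient, gradient_eq_gr hu.contDiff] using h

theorem IsNLW.integrable_enD (hu : IsNLW u) (t : ℝ) :
    Integrable fun x => enD (uncurry u) (t, x) := by
  simp only [enD_eq]
  exact (((hu.integrable_dt_sq t).const_mul _).add ((hu.integrable_gr_sq t).const_mul _)).add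
    ((hu.integrable_pow_six t).const_mul _)

theorem IsNLW.integral_enD (hu : IsNLW u) (t : ℝ) :
    ∫ x, enD (uncurry u) (t, x) = energy u t := by
  simp only [enD_eq, energy, tderiv_eq_dt hu.contDiff, gradient_eq_gr hu.contDiff]
  rfl

end Bridge

section Densities

variable {U : ℝ × E3 → ℝ}

theorem continuous_gr (hU : ContDiff ℝ (⊤ : ℕ∞) U) : Continuous (gr U) :=
  (PiLp.continuous_toLp 2 _).comp (continuous_pi fun k => (hU.dx k).continuous)

theorem continuous_qD (hU : ContDiff ℝ (⊤ : ℕ∞) U) : Continuous (qD U) := by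
  have h1 := continuous_gr hU
  have h2 := hU.dt.continuous
  have h3 := hU.continuous
  unfold qD
  fun_prop

theorem continuous_pD (hU : ContDiff ℝ (⊤ : ℕ∞) U) : Continuous (pD U) := by
  have h1 := continuous_gr hU
  have h2 := hU.dt.continuous
  have h3 := hU.continuous
  unfold pD
  fun_prop

theorem qD_nonneg (z : ℝ × E3) : 0 ≤ qD U z := by unfold qD; positivity

theorem pD_nonneg (z : ℝ × E3) : 0 ≤ pD U z := by unfold pD; positivity

theorem qD_le (z : ℝ × E3) : qD U z ≤ enD U z := by
  rw [enD_eq, qD]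
  nlinarith [mul_nonneg (norm_nonneg (gr U z)) (abs_nonneg (dt U z)), sq_abs (dt U z)]

theorem pD_le (z : ℝ × E3) : pD U z ≤ 4 * enD U z := by
  rw [enD_eq, pD]
  nlinarith [sq_nonneg (dt U z), sq_nonneg ‖gr U z‖]

theorem integrable_qD (hU : ContDiff ℝ (⊤ : ℕ∞) U) {t : ℝ}
    (he : Integrable fun x => enD U (t, x)) : Integrable fun x => qD U (t, x) := by
  refine he.mono' ((continuous_qD hU).comp (by fun_prop)).aestronglyMeasurable
    (.of_forall fun x => ?_)
  rw [norm_eq_abs, abs_of_nonneg (qD_nonneg _)]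
  exact qD_le _

theorem integrable_pD (hU : ContDiff ℝ (⊤ : ℕ∞) U) {t : ℝ}
    (he : Integrable fun x => enD U (t, x)) : Integrable fun x => pD U (t, x) := by
  refine (he.const_mul 4).mono' ((continuous_pD hU).comp (by fun_prop)).aestronglyMeasurable
    (.of_forall fun x => ?_)
  rw [norm_eq_abs, abs_of_nonneg (pD_nonneg _)]
  exact pD_le _

theorem integrable_interaction (hU : ContDiff ℝ (⊤ : ℕ∞) U) {t : ℝ}
    (he : Integrable fun x => enD U (t, x)) {Φ : E3 → ℝ} (hΦ : Continuous Φ)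
    (hΦc : HasCompactSupport Φ) :
    Integrable fun w : E3 × E3 => qD U (t, w.1) * Φ (w.1 - w.2) * pD U (t, w.2) := by
  obtain ⟨C, hC⟩ := hΦc.exists_bound_of_continuous hΦ
  have h := ((integrable_qD hU he).mul_prod (integrable_pD hU he)).const_mul C
  refine h.mono' ?_ (.of_forall fun w => ?_)
  · have h1 := continuous_qD hU
    have h2 := continuous_pD hU
    exact Continuous.aestronglyMeasurable (by fun_prop)
  · rw [norm_mul, norm_mul, norm_of_nonneg (qD_nonneg _), norm_of_nonneg (pD_nonneg _)]
    nlinarith [mul_le_mul_of_nonneg_right (hC (w.1 - w.2))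
      (mul_nonneg (qD_nonneg (U := U) (t, w.1)) (pD_nonneg (U := U) (t, w.2)))]

/-- The interaction energy with the Hardy term is controlled by the square of the energy. -/
theorem integral_hD_le (hU : ContDiff ℝ (⊤ : ℕ∞) U) {t ε E : ℝ} (hε : 0 < ε)
    (he : Integrable fun x => enD U (t, x)) (h2 : Integrable fun x => U (t, x) ^ 2)
    (hE : ∫ x, enD U (t, x) ≤ E) :
    Integrable (hD U ε t) ∧ ∫ w, hD U ε t w ≤ 9 * E ^ 2 := by
  have hec := (contDiff_enD hU).continuous
  have hUc := hU.continuous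
  have hN : ∀ z : E3, 0 < ‖z‖ ^ 2 + ε := fun z => by positivity
  have hI : Integrable (hD U ε t) := by
    have h := he.mul_prod (he.add (h2.mul_const (1 / ε)))
    refine h.mono' (Continuous.aestronglyMeasurable ?_) (.of_forall fun w => ?_)
    · refine (hec.comp (by fun_prop)).mul ((hec.comp (by fun_prop)).add
        (((hUc.comp (by fun_prop)).pow 2).div₀ (by fun_prop) fun w => (hN _).ne'))
    · have h0 := enD_nonneg U (t, w.1)
      have h1 := enD_nonneg U (t, w.2)
      have h3 := hN (w.1 - w.2)
      rw [norm_of_nonneg (by unfold hD; positivity), hD]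
      simp only [Pi.add_apply]
      rw [div_eq_mul_one_div (U (t, w.2) ^ 2)]
      gcongr
      nlinarith [sq_nonneg ‖w.1 - w.2‖]
  refine ⟨hI, ?_⟩
  have hE0 : 0 ≤ ∫ x, enD U (t, x) := integral_nonneg fun x => enD_nonneg _ _
  have hf : ContDiff ℝ (⊤ : ℕ∞) fun y => U (t, y) := hU.comp (contDiff_prodMk_right t)
  have hgn : ∀ y, ‖fderiv ℝ (fun y => U (t, y)) y‖ ^ 2 = ‖gr U (t, y)‖ ^ 2 := fun y => by
    rw [← norm_gradient]
    congr 2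
    ext k
    rw [gradient_apply]
    exact fderiv_slice hU t y k
  have hg : ∀ z, ‖gr U z‖ ^ 2 ≤ 2 * enD U z := fun z => by
    rw [enD_eq]; nlinarith [sq_nonneg (dt U z), show 0 ≤ U z ^ 6 by positivity]
  have hgi : Integrable fun y => ‖fderiv ℝ (fun y => U (t, y)) y‖ ^ 2 := by
    simp only [hgn]
    refine (he.const_mul 2).mono' (((continuous_gr hU).comp
      (by fun_prop)).norm.pow 2).aestronglyMeasurable (.of_forall fun x => ?_)
    rw [norm_of_nonneg (by positivity)]
    exact hg _
  have hgI : ∫ y, ‖fderiv ℝ (fun y => U (t, y)) y‖ ^ 2 ≤ 2 * E := by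
    calc _ ≤ ∫ y, 2 * enD U (t, y) := integral_mono hgi (he.const_mul 2) fun y => by
          simp only [hgn]; exact hg _
      _ ≤ 2 * E := by rw [integral_const_mul]; linarith
  have hin : ∀ x, ∫ y, hD U ε t (x, y) ≤ enD U (t, x) * (9 * E) := fun x => by
    obtain ⟨hi, hl⟩ := hardy hf h2 hgi hε x
    simp only [hD]
    rw [integral_const_mul, integral_add he hi]
    exact mul_le_mul_of_nonneg_left (by linarith) (enD_nonneg _ _)
  rw [Measure.volume_eq_prod, integral_prod _ hI]
  calc _ ≤ ∫ x, enD U (t, x) * (9 * E) := integral_mono hI.integral_prod_left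
        (he.mul_const _) hin
    _ ≤ 9 * E ^ 2 := by
      rw [integral_mul_const]; nlinarith

end Densities

open Filter Topology

/-- A sequence of smooth cutoffs exhausting `ℝ³` with gradients tending to zero. -/
theorem exists_cutoff_seq : ∃ (χ : ℕ → E3 → ℝ) (X : ℕ → ℝ),
    (∀ n, ContDiff ℝ (⊤ : ℕ∞) (χ n)) ∧ (∀ n, HasCompactSupport (χ n)) ∧
    (∀ n x, 0 ≤ χ n x) ∧ (∀ n x, χ n x ≤ 1) ∧ (∀ n x, ‖fderiv ℝ (χ n) x‖ ≤ X n) ∧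
    Tendsto X atTop (𝓝 0) ∧ ∀ x, Tendsto (fun n => χ n x) atTop (𝓝 1) := by
  let b : ContDiffBump (0 : E3) := ⟨1, 2, one_pos, one_lt_two⟩
  have hb : ContDiff ℝ (⊤ : ℕ∞) b := b.contDiff
  obtain ⟨C, hC⟩ := (b.hasCompactSupport.fderiv (𝕜 := ℝ)).exists_bound_of_continuous
    (hb.continuous_fderiv (by simp))
  have hn : ∀ n : ℕ, ((n : ℝ) + 1)⁻¹ ≠ 0 := fun n => by positivity
  refine ⟨fun n x => b (((n : ℝ) + 1)⁻¹ • x), fun n => C * (1 / ((n : ℝ) + 1)),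
    fun n => hb.comp (contDiff_const_smul _), fun n => b.hasCompactSupport.comp_smul (hn n),
    fun n x => b.nonneg, fun n x => b.le_one, fun n x => ?_, ?_, fun x => ?_⟩
  · have h : HasFDerivAt (fun x : E3 => b (((n : ℝ) + 1)⁻¹ • x)) _ x :=
      ((hb.differentiable (by simp) _).hasFDerivAt).comp x
        ((hasFDerivAt_id x).const_smul (((n : ℝ) + 1)⁻¹))
    rw [h.fderiv, ContinuousLinearMap.comp_smul, norm_smul, ContinuousLinearMap.comp_id,
      norm_of_nonneg (by positivity : (0 : ℝ) ≤ ((n : ℝ) + 1)⁻¹), mul_comm]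
    simp only [one_div]
    gcongr
    exact hC _
  · simpa using tendsto_one_div_add_atTop_nhds_zero_nat.const_mul C
  · refine tendsto_const_nhds.congr' ?_
    filter_upwards [eventually_ge_atTop ⌈‖x‖⌉₊] with n hx
    refine (b.one_of_mem_closedBall ?_).symm
    rw [mem_closedBall_zero_iff, norm_smul, norm_inv, norm_of_nonneg (by positivity),
      inv_mul_le_iff₀ (by positivity)]
    have : ‖x‖ ≤ n := (Nat.le_ceil _).trans (by exact_mod_cast hx)
    linarith [show b.rIn = 1 from rfl]

/-- The localized interaction quantity at a fixed time. -/
def Qint (U : ℝ × E3 → ℝ) (Φ : E3 → ℝ) (t : ℝ) : ℝ :=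
  ∫ w : E3 × E3, qD U (t, w.1) * Φ (w.1 - w.2) * pD U (t, w.2)

theorem continuous_cutoff_Qint {U : ℝ × E3 → ℝ} (hU : ContDiff ℝ (⊤ : ℕ∞) U) {χ Φ : E3 → ℝ}
    (hχ : Continuous χ) (hχc : HasCompactSupport χ) (hΦ : Continuous Φ)
    (hΦc : HasCompactSupport Φ) :
    Continuous fun t => ∫ w : E3 × E3,
      χ w.1 * (qD U (t, w.1) * Φ (w.1 - w.2) * pD U (t, w.2)) := by
  have hK := hasCompactSupport_kernel hχc hΦc
  have h1 := continuous_qD hU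
  have h2 := continuous_pD hU
  have h := continuous_parametric_integral_of_continuous (μ := (volume : Measure (E3 × E3)))
    (f := fun (t : ℝ) (w : E3 × E3) => χ w.1 * (qD U (t, w.1) * Φ (w.1 - w.2) * pD U (t, w.2)))
    (by simp only [Function.uncurry_def]; fun_prop) hK
  refine h.congr fun t => setIntegral_eq_integral_of_forall_compl_eq_zero fun w hw => ?_
  have h0 : χ w.1 * Φ (w.1 - w.2) = 0 := image_eq_zero_of_notMem_tsupport
    (f := fun w : E3 × E3 => χ w.1 * Φ (w.1 - w.2)) hw
  linear_combination qD U (t, w.1) * pD U (t, w.2) * h0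

/-- Interaction estimate integrated in time. -/
theorem integral_Qint_le {U : ℝ × E3 → ℝ} (hU : ContDiff ℝ (⊤ : ℕ∞) U)
    (hpde : ∀ z, dt (dt U) z = ∑ k, dx k (dx k U) z - U z ^ 5)
    (he : ∀ t, Integrable fun x => enD U (t, x)) (h2 : ∀ t, Integrable fun x => U (t, x) ^ 2)
    {E : ℝ} (hE : ∀ t, ∫ x, enD U (t, x) ≤ E) {Φ : E3 → ℝ} (hΦ : ContDiff ℝ (⊤ : ℕ∞) Φ)
    (hΦc : HasCompactSupport Φ) (hΦ0 : ∀ x, 0 ≤ Φ x) {ε L B : ℝ} (hε : 0 < ε)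
    (hL : ∀ x, √(‖x‖ ^ 2 + ε) * Φ x ≤ L) (hB : ∀ x, √(‖x‖ ^ 2 + ε) * ‖fderiv ℝ Φ x‖ ≤ B)
    {a b : ℝ} (hab : a ≤ b) :
    IntervalIntegrable (Qint U Φ) volume a b ∧
    ∫ t in a..b, Qint U Φ t ≤ (48 * L + 72 * B * (b - a)) * E ^ 2 := by
  obtain ⟨χ, X, hχ, hχc, hχ0, hχ1, hX, hXl, hχl⟩ := exists_cutoff_seq
  set Q : ℕ → ℝ → ℝ := fun n t => ∫ w : E3 × E3,
    χ n w.1 * (qD U (t, w.1) * Φ (w.1 - w.2) * pD U (t, w.2)) with hQ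
  have hQc : ∀ n, Continuous (Q n) := fun n =>
    continuous_cutoff_Qint hU (hχ n).continuous (hχc n) hΦ.continuous hΦc
  have hq := continuous_qD hU
  have hp := continuous_pD hU
  have hΦk := hΦ.continuous
  have hi : ∀ t, Integrable fun w : E3 × E3 => qD U (t, w.1) * Φ (w.1 - w.2) * pD U (t, w.2) :=
    fun t => integrable_interaction hU (he t) hΦ.continuous hΦc
  have hi0 : ∀ t (w : E3 × E3), 0 ≤ qD U (t, w.1) * Φ (w.1 - w.2) * pD U (t, w.2) :=
    fun t w => mul_nonneg (mul_nonneg (qD_nonneg _) (hΦ0 _)) (pD_nonneg _)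
  have hnorm : ∀ n t (w : E3 × E3), ‖χ n w.1 * (qD U (t, w.1) * Φ (w.1 - w.2) * pD U (t, w.2))‖ ≤
      qD U (t, w.1) * Φ (w.1 - w.2) * pD U (t, w.2) := fun n t w => by
    rw [norm_of_nonneg (mul_nonneg (hχ0 n _) (hi0 t w))]
    exact mul_le_of_le_one_left (hi0 t w) (hχ1 n _)
  have him : ∀ n t, AEStronglyMeasurable (fun w : E3 × E3 =>
      χ n w.1 * (qD U (t, w.1) * Φ (w.1 - w.2) * pD U (t, w.2))) := fun n t => by
    have := (hχ n).continuous
    exact Continuous.aestronglyMeasurable (by fun_prop)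
  have hlim : ∀ t, Tendsto (fun n => Q n t) atTop (𝓝 (Qint U Φ t)) := fun t => by
    refine tendsto_integral_of_dominated_convergence _ (fun n => him n t) (hi t)
      (fun n => .of_forall (hnorm n t)) (.of_forall fun w => ?_)
    simpa using (hχl w.1).mul_const (qD U (t, w.1) * Φ (w.1 - w.2) * pD U (t, w.2))
  have hE0 : 0 ≤ E := (integral_nonneg fun x => enD_nonneg U (0, x)).trans (hE 0)
  obtain ⟨C, hC⟩ := hΦc.exists_bound_of_continuous hΦ.continuous
  have hQle : ∀ t, Qint U Φ t ≤ C * (E * (4 * E)) := fun t => by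
    have hq1 := integrable_qD hU (he t)
    have hp1 := integrable_pD hU (he t)
    have hqE : ∫ x, qD U (t, x) ≤ E :=
      (integral_mono hq1 (he t) fun x => qD_le _).trans (hE t)
    have hpE : ∫ x, pD U (t, x) ≤ 4 * E := by
      refine (integral_mono hp1 ((he t).const_mul 4) fun x => pD_le _).trans ?_
      rw [integral_const_mul]; linarith [hE t]
    have hp0 : 0 ≤ ∫ x, pD U (t, x) := integral_nonneg fun x => pD_nonneg _
    have hC0 : 0 ≤ C := (norm_nonneg _).trans (hC 0)
    calc _ ≤ ∫ w : E3 × E3, C * (qD U (t, w.1) * pD U (t, w.2)) := by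
          refine integral_mono (hi t) ((hq1.mul_prod hp1).const_mul C) fun w => ?_
          have := mul_le_mul_of_nonneg_right ((le_abs_self _).trans (hC (w.1 - w.2)))
            (mul_nonneg (qD_nonneg (U := U) (t, w.1)) (pD_nonneg (U := U) (t, w.2)))
          simp only
          linarith
      _ = C * ((∫ x, qD U (t, x)) * ∫ x, pD U (t, x)) := by
          rw [integral_const_mul, Measure.volume_eq_prod,
            integral_prod_mul (fun x => qD U (t, x)) fun x => pD U (t, x)]
      _ ≤ _ := by gcongr
  have hQ0 : ∀ t, 0 ≤ Qint U Φ t := fun t => integral_nonneg (hi0 t)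
  have hQb : ∀ n t, ‖Q n t‖ ≤ C * (E * (4 * E)) := fun n t =>
    (norm_integral_le_of_norm_le (hi t) (.of_forall (hnorm n t))).trans (hQle t)
  have hmeas : Measurable (Qint U Φ) :=
    measurable_of_tendsto_metrizable (fun n => (hQc n).measurable) (tendsto_pi_nhds.2 hlim)
  have hint : IntervalIntegrable (Qint U Φ) volume a b := by
    refine (intervalIntegrable_const (c := C * (E * (4 * E)))).mono_fun
      hmeas.aestronglyMeasurable (.of_forall fun t => ?_)
    change ‖Qint U Φ t‖ ≤ ‖C * (E * (4 * E))‖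
    rw [norm_of_nonneg (hQ0 t)]
    exact (hQle t).trans (le_abs_self _)
  refine ⟨hint, ?_⟩
  have hIlim : Tendsto (fun n => ∫ t in a..b, Q n t) atTop (𝓝 (∫ t in a..b, Qint U Φ t)) := by
    refine intervalIntegral.tendsto_integral_filter_of_dominated_convergence
      (fun _ => C * (E * (4 * E))) (.of_forall fun n => (hQc n).aestronglyMeasurable)
      (.of_forall fun n => .of_forall fun t _ => hQb n t) intervalIntegrable_const
      (.of_forall fun t _ => hlim t)
  have hH := fun t => integral_hD_le hU hε (he t) (h2 t) (hE t)
  have hbound : ∀ n, ∫ t in a..b, Q n t ≤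
      4 / 3 * (4 * L * (9 * E ^ 2) + (6 * B + 2 * X n * L) * (9 * E ^ 2) * (b - a)) := fun n => by
    obtain ⟨M, M', hM, hMb, hM'⟩ := exists_interaction_functional hU hpde (hχ n) (hχc n) hΦ hΦc
      (hχ0 n) (hχ1 n) (hX n) hΦ0 hε hL hB (fun t => (hH t).1) (fun t => (hH t).2)
      fun t => (hi t).mono' (him n t) (.of_forall (hnorm n t))
    have hMc : Continuous M := continuous_iff_continuousAt.2 fun t => (hM t).continuousAt
    have h := intervalIntegral.integral_le_sub_of_hasDeriv_right_of_le (g := fun t => -M t)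
      (g' := fun t => -M' t)
      (φ := fun t => 3 / 4 * Q n t - (6 * B + 2 * X n * L) * (9 * E ^ 2)) hab
      hMc.neg.continuousOn (fun t _ => (hM t).neg.hasDerivWithinAt)
      (((hQc n).const_mul _).sub continuous_const).continuousOn.integrableOn_Icc
      (fun t _ => by have := hM' t; simp only [hQ]; linarith)
    rw [intervalIntegral.integral_sub (((hQc n).const_mul _).intervalIntegrable _ _)
      intervalIntegrable_const, intervalIntegral.integral_const_mul,
      intervalIntegral.integral_const, smul_eq_mul] at h
    have ha := abs_le.1 (hMb a)
    have hb := abs_le.1 (hMb b)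
    linarith [ha.1, ha.2, hb.1, hb.2]
  refine le_of_tendsto_of_tendsto' hIlim ?_ hbound
  have := ((((((hXl.const_mul 2).mul_const L).const_add (6 * B)).mul_const (9 * E ^ 2)).mul_const
    (b - a)).const_add (4 * L * (9 * E ^ 2))).const_mul (4 / 3)
  convert this using 2
  ring

theorem intervalIntegrable_Qint {U : ℝ × E3 → ℝ} (hU : ContDiff ℝ (⊤ : ℕ∞) U)
    (hpde : ∀ z, dt (dt U) z = ∑ k, dx k (dx k U) z - U z ^ 5)
    (he : ∀ t, Integrable fun x => enD U (t, x)) (h2 : ∀ t, Integrable fun x => U (t, x) ^ 2)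
    {E : ℝ} (hE : ∀ t, ∫ x, enD U (t, x) ≤ E) {Φ : E3 → ℝ} (hΦ : ContDiff ℝ (⊤ : ℕ∞) Φ)
    (hΦc : HasCompactSupport Φ) (hΦ0 : ∀ x, 0 ≤ Φ x) {a b : ℝ} (hab : a ≤ b) :
    IntervalIntegrable (Qint U Φ) volume a b := by
  have hs : Continuous fun x : E3 => √(‖x‖ ^ 2 + 1) := by fun_prop
  obtain ⟨L, hL⟩ := (hΦc.mul_left (f := fun x : E3 => √(‖x‖ ^ 2 + 1))).exists_bound_of_continuous
    (hs.mul hΦ.continuous)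
  obtain ⟨B, hB⟩ := ((hΦc.fderiv (𝕜 := ℝ)).norm.mul_left
    (f := fun x : E3 => √(‖x‖ ^ 2 + 1))).exists_bound_of_continuous
    (hs.mul (hΦ.continuous_fderiv (by simp)).norm)
  exact (integral_Qint_le hU hpde he h2 hE hΦ hΦc hΦ0 one_pos
    (fun x => (le_abs_self _).trans (hL x)) (fun x => (le_abs_self _).trans (hB x)) hab).1

theorem sum_exp_range_succ_le (n : ℕ) :
    ∑ k ∈ Finset.range (n + 1), Real.exp (k : ℝ) ≤ 2 * Real.exp n := by
  induction n with
  | zero => simp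
  | succ n ih =>
    rw [Finset.sum_range_succ]
    have h : 2 * Real.exp (n : ℝ) ≤ Real.exp ((n + 1 : ℕ) : ℝ) := by
      push_cast
      rw [Real.exp_add, mul_comm]
      gcongr
      linarith [Real.add_one_le_exp (1 : ℝ)]
    linarith

section Multiscale

variable {φ : E3 → ℝ}

theorem hasCompactSupport_of_eq_zero (h0 : ∀ x : E3, 2 ≤ ‖x‖ → φ x = 0) :
    HasCompactSupport φ :=
  HasCompactSupport.of_support_subset_isCompact (isCompact_closedBall (0 : E3) 2) fun x hx => by
    rw [mem_closedBall_zero_iff]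
    by_contra h
    exact hx (h0 x (not_le.1 h).le)

theorem fderiv_eq_zero_of_annulus (h1 : ∀ x : E3, ‖x‖ ≤ 1 → φ x = 1)
    (h0 : ∀ x : E3, 2 ≤ ‖x‖ → φ x = 0) {x : E3} (hx : ‖x‖ < 1 ∨ 2 < ‖x‖) :
    fderiv ℝ φ x = 0 := by
  rcases hx with hx | hx
  · have h : φ =ᶠ[𝓝 x] fun _ => 1 := by
      filter_upwards [(continuous_norm.tendsto x).eventually_lt_const hx] with y hy
      exact h1 y hy.le
    rw [h.fderiv_eq]; simp
  · have h : φ =ᶠ[𝓝 x] fun _ => 0 := by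
      filter_upwards [(continuous_norm.tendsto x).eventually_const_lt hx] with y hy
      exact h0 y hy.le
    rw [h.fderiv_eq]; simp

theorem fderiv_comp_inv_smul (hsm : ContDiff ℝ (⊤ : ℕ∞) φ) (R : ℝ) (x : E3) :
    fderiv ℝ (fun x => φ (R⁻¹ • x)) x = R⁻¹ • fderiv ℝ φ (R⁻¹ • x) := by
  have h : HasFDerivAt (fun x : E3 => φ (R⁻¹ • x)) _ x :=
    ((hsm.differentiable (by simp) _).hasFDerivAt).comp x ((hasFDerivAt_id x).const_smul R⁻¹)
  rw [h.fderiv, ContinuousLinearMap.comp_smul, ContinuousLinearMap.comp_id]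

theorem sqrt_norm_sq_add_sq_le {R₀ R : ℝ} (h0 : 0 ≤ R₀) (hR : R₀ ≤ R) {x : E3}
    (hx : ‖x‖ ≤ 2 * R) : √(‖x‖ ^ 2 + R₀ ^ 2) ≤ 3 * R := by
  rw [sqrt_le_left (by linarith)]
  nlinarith [norm_nonneg x]

/-- The superposition of dyadic (base `e`) rescalings of a bump function. -/
def multiscale (φ : E3 → ℝ) (R₀ : ℝ) (n : ℕ) (x : E3) : ℝ :=
  ∑ k ∈ Finset.range (n + 1), φ ((Real.exp (k : ℝ) * R₀)⁻¹ • x)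

theorem le_exp_mul {R₀ : ℝ} (hR : 0 < R₀) (k : ℕ) : R₀ ≤ Real.exp (k : ℝ) * R₀ :=
  le_mul_of_one_le_left hR.le (Real.one_le_exp (by positivity))

theorem contDiff_multiscale (hsm : ContDiff ℝ (⊤ : ℕ∞) φ) (R₀ : ℝ) (n : ℕ) :
    ContDiff ℝ (⊤ : ℕ∞) (multiscale φ R₀ n) :=
  ContDiff.sum fun _ _ => hsm.comp (contDiff_const_smul _)

theorem sqrt_mul_multiscale_le (hle : ∀ x, φ x ≤ 1)
    (h0 : ∀ x : E3, 2 ≤ ‖x‖ → φ x = 0) {R₀ : ℝ} (hR : 0 < R₀) (n : ℕ) (x : E3) :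
    √(‖x‖ ^ 2 + R₀ ^ 2) * multiscale φ R₀ n x ≤ 6 * (Real.exp n * R₀) := by
  rw [multiscale, Finset.mul_sum]
  calc _ ≤ ∑ k ∈ Finset.range (n + 1), 3 * R₀ * Real.exp (k : ℝ) := by
        refine Finset.sum_le_sum fun k _ => ?_
        have hRk : 0 < Real.exp (k : ℝ) * R₀ := by positivity
        by_cases hx : 2 * (Real.exp (k : ℝ) * R₀) ≤ ‖x‖
        · rw [h0, mul_zero]
          · positivity
          · rw [norm_smul, norm_inv, norm_of_nonneg hRk.le, le_inv_mul_iff₀ hRk]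
            linarith
        · have := sqrt_norm_sq_add_sq_le hR.le (le_exp_mul hR k) (not_le.1 hx).le
          calc _ ≤ √(‖x‖ ^ 2 + R₀ ^ 2) * 1 := by gcongr; exact hle _
            _ ≤ _ := by linarith
    _ ≤ _ := by
        rw [← Finset.mul_sum]
        nlinarith [sum_exp_range_succ_le n]

theorem sqrt_mul_norm_fderiv_multiscale_le (hsm : ContDiff ℝ (⊤ : ℕ∞) φ)
    (h1 : ∀ x : E3, ‖x‖ ≤ 1 → φ x = 1) (h0 : ∀ x : E3, 2 ≤ ‖x‖ → φ x = 0) {C R₀ : ℝ}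
    (hC : ∀ x, ‖fderiv ℝ φ x‖ ≤ C) (hR : 0 < R₀) (n : ℕ) (x : E3) :
    √(‖x‖ ^ 2 + R₀ ^ 2) * ‖fderiv ℝ (multiscale φ R₀ n) x‖ ≤ 3 * C := by
  have hC0 : 0 ≤ C := (norm_nonneg _).trans (hC 0)
  have hRk : ∀ k : ℕ, 0 < Real.exp (k : ℝ) * R₀ := fun k => by positivity
  have hd : ∀ k : ℕ, DifferentiableAt ℝ (fun x => φ ((Real.exp (k : ℝ) * R₀)⁻¹ • x)) x :=
    fun k => (hsm.comp (contDiff_const_smul _)).differentiable (by simp) x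
  have e : fderiv ℝ (multiscale φ R₀ n) x = ∑ k ∈ Finset.range (n + 1),
      (Real.exp (k : ℝ) * R₀)⁻¹ • fderiv ℝ φ ((Real.exp (k : ℝ) * R₀)⁻¹ • x) := by
    have h : HasFDerivAt (multiscale φ R₀ n) _ x :=
      HasFDerivAt.fun_sum fun k (_ : k ∈ Finset.range (n + 1)) => (hd k).hasFDerivAt
    rw [h.fderiv]
    exact Finset.sum_congr rfl fun k _ => fderiv_comp_inv_smul hsm _ x
  have hann : ∀ k : ℕ, (Real.exp (k : ℝ) * R₀)⁻¹ • fderiv ℝ φ ((Real.exp (k : ℝ) * R₀)⁻¹ • x) ≠ 0 →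
      Real.exp (k : ℝ) * R₀ ≤ ‖x‖ ∧ ‖x‖ ≤ 2 * (Real.exp (k : ℝ) * R₀) := fun k hk => by
    by_contra hcon
    refine hk ?_
    rw [fderiv_eq_zero_of_annulus h1 h0, smul_zero]
    rw [norm_smul, norm_inv, norm_of_nonneg (hRk k).le, inv_mul_lt_iff₀ (hRk k),
      lt_inv_mul_iff₀ (hRk k)]
    by_contra! hcon'
    exact hcon ⟨by linarith [hcon'.1], by linarith [hcon'.2]⟩
  have hlt : ∀ k l : ℕ, k < l → 2 * (Real.exp (k : ℝ) * R₀) < Real.exp (l : ℝ) * R₀ :=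
    fun k l hkl => by
    have h3 : Real.exp ((k : ℝ) + 1) ≤ Real.exp (l : ℝ) :=
      Real.exp_le_exp.2 (by exact_mod_cast hkl)
    rw [Real.exp_add] at h3
    have h4 : 2 < Real.exp 1 := by linarith [Real.add_one_lt_exp (one_ne_zero (α := ℝ))]
    have h5 : Real.exp (k : ℝ) * 2 < Real.exp (k : ℝ) * Real.exp 1 := by gcongr
    nlinarith
  by_cases hex : ∃ k ∈ Finset.range (n + 1),
      (Real.exp (k : ℝ) * R₀)⁻¹ • fderiv ℝ φ ((Real.exp (k : ℝ) * R₀)⁻¹ • x) ≠ 0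
  · obtain ⟨k, hk, hne⟩ := hex
    have hs : fderiv ℝ (multiscale φ R₀ n) x =
        (Real.exp (k : ℝ) * R₀)⁻¹ • fderiv ℝ φ ((Real.exp (k : ℝ) * R₀)⁻¹ • x) := by
      rw [e]
      refine Finset.sum_eq_single_of_mem k hk fun l _ hlk => ?_
      by_contra hl
      have ha := hann k hne
      have hb := hann l hl
      rcases lt_or_gt_of_ne hlk with h | h
      · linarith [hlt l k h]
      · linarith [hlt k l h]
    have h3 := sqrt_norm_sq_add_sq_le hR.le (le_exp_mul hR k) (hann k hne).2
    rw [hs, norm_smul, norm_inv, norm_of_nonneg (hRk k).le]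
    calc _ ≤ 3 * (Real.exp (k : ℝ) * R₀) * ((Real.exp (k : ℝ) * R₀)⁻¹ * C) := by
          gcongr; exact hC _
      _ = 3 * C := by field_simp
  · push Not at hex
    rw [e, Finset.sum_eq_zero hex]
    simpa using hC0

theorem hasCompactSupport_comp_inv_smul (hc : HasCompactSupport φ) {R : ℝ} (hR : 0 < R) :
    HasCompactSupport fun x => φ (R⁻¹ • x) :=
  hc.comp_smul (inv_ne_zero hR.ne')

theorem hasCompactSupport_multiscale (hc : HasCompactSupport φ) {R₀ : ℝ} (hR : 0 < R₀) (n : ℕ) :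
    HasCompactSupport (multiscale φ R₀ n) := by
  unfold multiscale
  generalize Finset.range (n + 1) = s
  induction s using Finset.induction_on with
  | empty =>
    simp only [Finset.sum_empty]
    exact HasCompactSupport.zero
  | insert k s hk ih =>
    simp only [Finset.sum_insert hk]
    exact (hasCompactSupport_comp_inv_smul hc (by positivity)).add ih

end Multiscale

theorem Qint_multiscale {U : ℝ × E3 → ℝ} (hU : ContDiff ℝ (⊤ : ℕ∞) U) {t : ℝ}
    (he : Integrable fun x => enD U (t, x)) {φ : E3 → ℝ} (hφ : Continuous φ)
    (hc : HasCompactSupport φ) {R₀ : ℝ} (hR : 0 < R₀) (n : ℕ) :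
    Qint U (multiscale φ R₀ n) t = ∑ k ∈ Finset.range (n + 1),
      Qint U (fun x => φ ((Real.exp (k : ℝ) * R₀)⁻¹ • x)) t := by
  unfold Qint
  rw [← integral_finsetSum]
  · simp only [multiscale, Finset.mul_sum, Finset.sum_mul]
  · exact fun k _ => integrable_interaction hU he (by fun_prop)
      (hasCompactSupport_comp_inv_smul hc (by positivity))

theorem integral_integral_eq_Qint {u : ℝ → E3 → ℝ} (hu : IsNLW u) {Φ : E3 → ℝ}
    (hΦ : Continuous Φ) (hΦc : HasCompactSupport Φ) (t : ℝ) :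
    ∫ y : E3, ∫ x : E3,
      ((1/2) * (‖gradient (u t) x‖ - |tderiv u t x|) ^ 2 + (1/6) * (u t x) ^ 6) *
        Φ (x - y) *
        ((1/2) * (tderiv u t y) ^ 2 + (1/2) * ‖gradient (u t) y‖ ^ 2 + (2/3) * (u t y) ^ 6) =
    Qint (uncurry u) Φ t := by
  have hU := hu.contDiff
  rw [Qint, Measure.volume_eq_prod,
    integral_prod_symm _ (integrable_interaction hU (hu.integrable_enD t) hΦ hΦc)]
  simp only [tderiv_eq_dt hU, gradient_eq_gr hU]
  rfl

/-- existence of a time `t₀ ∈ [a+T, a+𝒯+T]` and radius `R ∈ [R₀, e^J R₀]`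
at which the localized interaction quantity over `[t₀-T, t₀]` is `≤ C T E²/J`. -/
theorem stmt14 (φ : E3 → ℝ) (hsm : ContDiff ℝ (⊤ : ℕ∞) φ) (hpos : ∀ x, 0 ≤ φ x)
    (hrad : ∀ x y : E3, ‖x‖ = ‖y‖ → φ x = φ y)
    (hmono : ∀ x y : E3, ‖x‖ ≤ ‖y‖ → φ y ≤ φ x)
    (h1 : ∀ x : E3, ‖x‖ ≤ 1 → φ x = 1) (h0 : ∀ x : E3, 2 ≤ ‖x‖ → φ x = 0) :
    ∃ C : ℝ, 0 < C ∧ ∀ (E : ℝ) (u : ℝ → E3 → ℝ), IsNLW u → (∀ t : ℝ, energy u t ≤ E) →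
      ∀ (R₀ J a T : ℝ), 0 < R₀ → 1 ≤ J → 0 < T → T ≤ Real.exp J * R₀ →
      ∃ t₀ ∈ Icc (a + T) (a + Real.exp J * R₀ + T), ∃ R ∈ Icc R₀ (Real.exp J * R₀),
        (∫ t in (t₀ - T)..t₀,
          ∫ y : E3, ∫ x : E3,
            ((1/2) * (‖gradient (u t) x‖ - |tderiv u t x|) ^ 2 + (1/6) * (u t x) ^ 6) *
              φ (R⁻¹ • (x - y)) *
              ((1/2) * (tderiv u t y) ^ 2 + (1/2) * ‖gradient (u t) y‖ ^ 2 +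
                (2/3) * (u t y) ^ 6))
          ≤ C * T * E ^ 2 / J := by
  have hc := hasCompactSupport_of_eq_zero h0
  have hle : ∀ x, φ x ≤ 1 := fun x =>
    (hmono 0 x (by simp)).trans (h1 0 (by simp)).le
  obtain ⟨C, hC⟩ := (hc.fderiv (𝕜 := ℝ)).exists_bound_of_continuous
    (hsm.continuous_fderiv (by simp))
  have hC0 : 0 ≤ C := (norm_nonneg _).trans (hC 0)
  refine ⟨288 + 432 * C, by positivity, fun E u hu hE R₀ J a T hR hJ hT hTJ => ?_⟩
  have hU := hu.contDiff
  have hE' : ∀ t, ∫ x, enD (uncurry u) (t, x) ≤ E := fun t => (hu.integral_enD t).trans_le (hE t)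
  set S := Real.exp J * R₀ with hS
  have hS0 : 0 < S := by positivity
  set n := ⌊J⌋₊ with hn
  have hnJ : (n : ℝ) ≤ J := Nat.floor_le (by linarith)
  have hJn : J < (n : ℝ) + 1 := Nat.lt_floor_add_one J
  set N := ⌊S / T⌋₊ + 1 with hN
  have hNle : (N : ℝ) ≤ S / T + 1 := by
    rw [hN]; push_cast; linarith [Nat.floor_le (show 0 ≤ S / T by positivity)]
  have hltN : S / T < N := by rw [hN]; push_cast; exact Nat.lt_floor_add_one _
  have hNT : S ≤ N * T := by rw [div_lt_iff₀ hT] at hltN; exact hltN.le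
  have hNT2 : N * T ≤ 2 * S := by
    have := mul_le_mul_of_nonneg_right hNle hT.le
    rw [add_mul, div_mul_cancel₀ _ hT.ne'] at this
    linarith
  set ψ : ℕ → E3 → ℝ := fun k x => φ ((Real.exp (k : ℝ) * R₀)⁻¹ • x) with hψ
  have hψs : ∀ k, ContDiff ℝ (⊤ : ℕ∞) (ψ k) := fun k => hsm.comp (contDiff_const_smul _)
  have hψc : ∀ k, HasCompactSupport (ψ k) := fun k =>
    hasCompactSupport_comp_inv_smul hc (by positivity)
  have hψi : ∀ k {b c : ℝ}, b ≤ c → IntervalIntegrable (Qint (uncurry u) (ψ k)) volume b c :=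
    fun k b c hbc => intervalIntegrable_Qint hU hu.dt_dt hu.integrable_enD hu.integrable_sq hE'
      (hψs k) (hψc k) (fun x => hpos _) hbc
  have hmain := (integral_Qint_le hU hu.dt_dt hu.integrable_enD hu.integrable_sq hE'
    (contDiff_multiscale hsm R₀ n) (hasCompactSupport_multiscale hc hR n)
    (fun x => Finset.sum_nonneg fun k _ => hpos _) (pow_pos hR 2)
    (sqrt_mul_multiscale_le hle h0 hR n)
    (sqrt_mul_norm_fderiv_multiscale_le hsm h1 h0 hC hR n)
    (show a ≤ a + N * T by linarith)).2
  have hbound : ∫ t in a..a + N * T, Qint (uncurry u) (multiscale φ R₀ n) t ≤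
      (288 + 432 * C) * S * E ^ 2 := by
    refine hmain.trans (mul_le_mul_of_nonneg_right ?_ (sq_nonneg E))
    have h3 : Real.exp n * R₀ ≤ S := by rw [hS]; gcongr
    nlinarith [mul_le_mul_of_nonneg_left hNT2 hC0]
  have hsplit : ∫ t in a..a + N * T, Qint (uncurry u) (multiscale φ R₀ n) t =
      ∑ p ∈ Finset.range N ×ˢ Finset.range (n + 1),
        ∫ t in (a + p.1 * T)..(a + p.1 * T + T), Qint (uncurry u) (ψ p.2) t := by
    simp_rw [fun t => Qint_multiscale hU (hu.integrable_enD t) hsm.continuous hc hR n]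
    rw [intervalIntegral.integral_finsetSum fun k _ => hψi k (by linarith),
      Finset.sum_product_right]
    refine Finset.sum_congr rfl fun k _ => ?_
    have h := intervalIntegral.sum_integral_adjacent_intervals (μ := volume)
      (f := Qint (uncurry u) (ψ k)) (a := fun m : ℕ => a + m * T) (n := N)
      fun m _ => hψi k (by push_cast; linarith)
    simp only [Nat.cast_zero, zero_mul, add_zero, Nat.cast_add, Nat.cast_one, add_mul, one_mul,
      ← add_assoc] at h
    exact h.symm
  obtain ⟨⟨m, k⟩, hmk, hfin⟩ := Finset.exists_le_of_sum_le
    (s := Finset.range N ×ˢ Finset.range (n + 1))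
    (f := fun p => ∫ t in (a + p.1 * T)..(a + p.1 * T + T), Qint (uncurry u) (ψ p.2) t)
    (g := fun _ => (288 + 432 * C) * T * E ^ 2 / J)
    ⟨(0, 0), by simp [hN]⟩ (by
      rw [← hsplit, Finset.sum_const, Finset.card_product, Finset.card_range, Finset.card_range,
        nsmul_eq_mul]
      refine hbound.trans ?_
      push_cast
      have h4 : (288 + 432 * C) * S * E ^ 2 ≤ (288 + 432 * C) * (N * T) * E ^ 2 := by gcongr
      have h5 : N * T * ((288 + 432 * C) * E ^ 2) * J ≤
          N * T * ((288 + 432 * C) * E ^ 2) * (n + 1) := by gcongr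
      rw [mul_div_assoc', le_div_iff₀ (by linarith)]
      nlinarith [mul_le_mul_of_nonneg_right h4 (show 0 ≤ J by linarith)])
  rw [Finset.mem_product, Finset.mem_range, Finset.mem_range] at hmk
  have hm : (m : ℝ) * T ≤ S := by
    have : (m : ℝ) ≤ S / T := (Nat.le_floor_iff (by positivity)).1 (Nat.lt_succ_iff.1 hmk.1)
    rwa [le_div_iff₀ hT] at this
  have hkn : (k : ℝ) ≤ J := le_trans (by exact_mod_cast Nat.lt_succ_iff.1 hmk.2) hnJ
  refine ⟨a + m * T + T, ⟨by nlinarith [show 0 ≤ (m : ℝ) * T by positivity], by linarith⟩,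
    Real.exp (k : ℝ) * R₀, ⟨le_exp_mul hR k, by rw [hS]; gcongr⟩, ?_⟩
  rw [add_sub_cancel_right]
  refine (intervalIntegral.integral_congr fun t _ => ?_).trans_le hfin
  exact integral_integral_eq_Qint hu (hψs k).continuous (hψc k) t


end
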